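/- arXiv:1806.06211 — 9 statements merged into one kernel-verified Lean document; each statement's English description precedes it below -/
import Mathlib

section
/- Let X be a metric space, let Y be a proper connected metric space, and let f : X → Y be a homeomorphism satisfying the η-quasisymmetry condition. Then for every x ∈ X and every s with 0 < s < diam(Y)/2 there exists r > 0 such that B(f(x),s) ⊆ f(B̄(x,r)) ⊆ f(B(x,10r)) ⊆ B(f(x), η(10)·s). Moreover, if f⁻¹ is uniformly continuous with a nondecreasing modulus of continuity ω (that is, d_X(f⁻¹(y), f⁻¹(y')) ≤ ω(d_Y(y,y')) for all y, y' ∈ Y), then r can be chosen with r ≤ ω(s). -/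
open Metric MeasureTheory Filter Topology ENNReal NNReal Set

noncomputable section

variable {X Y : Type*} [MetricSpace X] [MetricSpace Y]

/-- `f` satisfies the `η`-quasisymmetry condition, where `η : [0,∞) → [0,∞)` is a
homeomorphism. -/
def IsQuasisymmetric (η : ℝ≥0 ≃ₜ ℝ≥0) (f : X → Y) : Prop :=
  ∀ ⦃x y z : X⦄, x ≠ y → x ≠ z → y ≠ z → ∀ t : ℝ≥0, 0 < t →
    nndist x y ≤ t * nndist x z → nndist (f x) (f y) ≤ η t * nndist (f x) (f z)

/-- A self-homeomorphism of `[0,∞)` is strictly increasing. -/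
theorem NNReal.strictMono_homeomorph (η : ℝ≥0 ≃ₜ ℝ≥0) : StrictMono η := by
  rcases η.continuous.strictMono_of_inj η.injective with h | h
  · exact h
  · obtain ⟨u, hu⟩ := η.surjective (η 0 + 1)
    have h0 : η u ≤ η 0 := h.antitone zero_le
    rw [hu] at h0
    exact absurd h0 (not_le.mpr (lt_add_of_pos_right _ one_pos))

/-- Near a non-isolated point, quasisymmetry forces `1 ≤ η t` for `t > 1`. -/
theorem IsQuasisymmetric.one_le {η : ℝ≥0 ≃ₜ ℝ≥0} {f : X → Y} (hf : IsQuasisymmetric η f)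
    {x z : X} (hxz : x ≠ z) (hfxz : f x ≠ f z) (hc : ContinuousAt f z) [(𝓝[≠] z).NeBot]
    {t : ℝ≥0} (ht : 1 < t) : 1 ≤ η t := by
  have hpos : 0 < nndist x z := pos_iff_ne_zero.mpr (nndist_eq_zero.not.mpr hxz)
  have hclose : ∀ᶠ w in 𝓝[≠] z, nndist x w < t * nndist x z := by
    have hcont : ContinuousAt (fun w => nndist x w) z := by fun_prop
    exact (hcont.eventually (gt_mem_nhds (lt_mul_of_one_lt_left hpos ht))).filter_mono
      nhdsWithin_le_nhds
  have hne : ∀ᶠ w in 𝓝[≠] z, x ≠ w :=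
    (eventually_ne_nhds hxz.symm).filter_mono nhdsWithin_le_nhds |>.mono fun _ h => h.symm
  have hbound : ∀ᶠ w in 𝓝[≠] z, nndist (f x) (f w) ≤ η t * nndist (f x) (f z) := by
    filter_upwards [hclose, hne, self_mem_nhdsWithin] with w h₁ h₂ h₃
    exact hf h₂ hxz h₃ t (one_pos.trans ht) h₁.le
  have hlim : Tendsto (fun w => nndist (f x) (f w)) (𝓝[≠] z) (𝓝 (nndist (f x) (f z))) :=
    (tendsto_const_nhds.nndist hc).mono_left nhdsWithin_le_nhds
  have hle := le_of_tendsto hlim hbound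
  have hfpos : 0 < nndist (f x) (f z) := pos_iff_ne_zero.mpr (nndist_eq_zero.not.mpr hfxz)
  exact le_of_mul_le_mul_right (by simpa using hle) hfpos

/-- If `z` is not isolated and `1 < T`, then `f` maps `B(x, T d(x,z))` into
`B(f x, η(T) d(f x, f z))`. -/
theorem IsQuasisymmetric.image_ball_subset {η : ℝ≥0 ≃ₜ ℝ≥0} {f : X → Y}
    (hf : IsQuasisymmetric η f) {x z : X} (hxz : x ≠ z) (hfxz : f x ≠ f z)
    (hc : ContinuousAt f z) [(𝓝[≠] z).NeBot] {T : ℝ≥0} (hT : 1 < T) :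
    f '' ball x (T * dist x z) ⊆ ball (f x) (η T * dist (f x) (f z)) := by
  have hmono := NNReal.strictMono_homeomorph η
  have hη : 1 < η T := by
    obtain ⟨t, h₁, h₂⟩ := exists_between hT
    exact (hf.one_le hxz hfxz hc h₁).trans_lt (hmono h₂)
  have hpos : 0 < nndist x z := pos_iff_ne_zero.mpr (nndist_eq_zero.not.mpr hxz)
  have hfpos : 0 < nndist (f x) (f z) := pos_iff_ne_zero.mpr (nndist_eq_zero.not.mpr hfxz)
  rintro _ ⟨y, hy, rfl⟩
  rw [mem_ball'] at hy ⊢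
  have hy' : nndist x y < T * nndist x z := by exact_mod_cast hy
  suffices nndist (f x) (f y) < η T * nndist (f x) (f z) by exact_mod_cast this
  rcases eq_or_ne x y with rfl | hxy
  · simpa using mul_pos (one_pos.trans hη) hfpos
  rcases eq_or_ne y z with rfl | hyz
  · exact lt_mul_of_one_lt_left hfpos hη
  have hxypos : 0 < nndist x y := pos_iff_ne_zero.mpr (nndist_eq_zero.not.mpr hxy)
  have hlt : nndist x y / nndist x z < T := (div_lt_iff₀ hpos).mpr hy'
  calc nndist (f x) (f y)
      ≤ η (nndist x y / nndist x z) * nndist (f x) (f z) :=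
        hf hxy hxz hyz _ (div_pos hxypos hpos) (div_mul_cancel₀ _ hpos.ne').ge
    _ < η T * nndist (f x) (f z) := mul_lt_mul_of_pos_right (hmono hlt) hfpos

/-- if `Y` is proper and connected and `f : X → Y` is an `η`-quasisymmetric
homeomorphism, then for every `x ∈ X` and `0 < s < diam(Y)/2` there exists `r > 0` with
`B(f x, s) ⊆ f(B̄(x,r)) ⊆ f(B(x,10r)) ⊆ B(f x, η(10)·s)`; moreover, if `f⁻¹` is uniformly
continuous with nondecreasing modulus of continuity `ω`, then `r` can be chosen with
`r ≤ ω s`. -/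
theorem stmt3 [ProperSpace Y] [ConnectedSpace Y]
    (η : ℝ≥0 ≃ₜ ℝ≥0) (f : X ≃ₜ Y) (hf : IsQuasisymmetric η (⇑f))
    (x : X) (s : ℝ) (hs : 0 < s)
    (hs2 : ENNReal.ofReal s < EMetric.diam (Set.univ : Set Y) / 2) :
    (∃ r : ℝ, 0 < r ∧
        Metric.ball (f x) s ⊆ ⇑f '' Metric.closedBall x r ∧
        ⇑f '' Metric.closedBall x r ⊆ ⇑f '' Metric.ball x (10 * r) ∧
        ⇑f '' Metric.ball x (10 * r) ⊆ Metric.ball (f x) ((η 10 : ℝ) * s)) ∧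
      (∀ ω : ℝ → ℝ, Monotone ω →
        (∀ y y' : Y, dist (f.symm y) (f.symm y') ≤ ω (dist y y')) →
        ∃ r : ℝ, 0 < r ∧ r ≤ ω s ∧
          Metric.ball (f x) s ⊆ ⇑f '' Metric.closedBall x r ∧
          ⇑f '' Metric.closedBall x r ⊆ ⇑f '' Metric.ball x (10 * r) ∧
          ⇑f '' Metric.ball x (10 * r) ⊆ Metric.ball (f x) ((η 10 : ℝ) * s)) := by
  have hnt : Nontrivial Y := by
    by_contra h
    rw [not_nontrivial_iff_subsingleton] at h
    have h0 : Metric.ediam (Set.univ : Set Y) = 0 :=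
      Metric.ediam_subsingleton Set.subsingleton_univ
    change ENNReal.ofReal s < Metric.ediam (Set.univ : Set Y) / 2 at hs2
    simp [h0] at hs2
  have hntX : Nontrivial X := f.toEquiv.nontrivial
  have hconn : ConnectedSpace X := f.symm.surjective.connectedSpace f.symm.continuous
  have hcont : ContinuousOn (fun y => dist x (f.symm y)) (closedBall (f x) s) := by fun_prop
  obtain ⟨w, hw, hmax⟩ := (isCompact_closedBall (f x) s).exists_isMaxOn
    ⟨f x, mem_closedBall_self hs.le⟩ hcont
  obtain ⟨z, rfl⟩ := f.surjective w
  have hmax' : ∀ y ∈ closedBall (f x) s, dist x (f.symm y) ≤ dist x z :=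
    fun y hy => by simpa using isMaxOn_iff.mp hmax y hy
  have hxz : x ≠ z := by
    rintro rfl
    obtain ⟨y, hy, hne⟩ := (Filter.nonempty_of_mem (inter_mem_nhdsWithin {f x}ᶜ
      (closedBall_mem_nhds (f x) hs)))
    have h0 := hmax' y hne
    rw [dist_self] at h0
    have hxy : x = f.symm y := dist_le_zero.mp h0
    exact hy (by simp [hxy])
  have hpos : 0 < dist x z := dist_pos.mpr hxz
  rw [mem_closedBall'] at hw
  have h₁ : ball (f x) s ⊆ f '' closedBall x (dist x z) := fun y hy =>
    ⟨f.symm y, mem_closedBall'.mpr (hmax' y (ball_subset_closedBall hy)), f.apply_symm_apply y⟩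
  have h₂ : f '' closedBall x (dist x z) ⊆ f '' ball x (10 * dist x z) :=
    image_mono (closedBall_subset_ball (by linarith))
  have h₃ : f '' ball x (10 * dist x z) ⊆ ball (f x) ((η 10 : ℝ) * s) :=
    (hf.image_ball_subset hxz (f.injective.ne hxz) f.continuous.continuousAt
      (T := 10) (by norm_num)).trans (ball_subset_ball (by gcongr))
  refine ⟨⟨dist x z, hpos, h₁, h₂, h₃⟩, fun ω hω hmod => ⟨dist x z, hpos, ?_, h₁, h₂, h₃⟩⟩
  calc dist x z ≤ ω (dist (f x) (f z)) := by simpa using hmod (f x) (f z)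
    _ ≤ ω s := hω hw
end
end

section
/- Let (X, μ_X) and (Y, μ_Y) be metric measure spaces whose measures are Borel measures that are positive and finite on all balls, and let f : X → Y be a homeomorphism. Assume there are constants a, b > 0 such that for every Borel set E ⊆ X and every x ∈ X one has D̄(f(E), f(x)) ≤ b·(D̄(E,x))^a and D_(f(E), f(x)) ≤ b·(D_(E,x))^a, and assume the analogous inequalities (with constants a', b' > 0) hold for f⁻¹ : Y → X. Then for every Borel set E ⊆ X: (i) for each β ∈ (0,1), Σ_β f(E) ⊆ f(Σ_{β₀} E) where β₀ = (β/b)^{1/a}; (ii) Σ f(E) = f(Σ E); and (iii) ∂* f(E) = f(∂* E). -/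
open Metric MeasureTheory Filter Topology ENNReal NNReal Set

noncomputable section

variable {X Y : Type*} [MetricSpace X] [MetricSpace Y]
  [MeasurableSpace X] [BorelSpace X] [MeasurableSpace Y] [BorelSpace Y]

/-- The upper density of `E` at `x` with respect to the measure `μ`. -/
def upperDensity (μ : Measure X) (E : Set X) (x : X) : ℝ≥0∞ :=
  limsup (fun r : ℝ => μ (Metric.ball x r ∩ E) / μ (Metric.ball x r)) (𝓝[>] (0 : ℝ))

/-- The lower density of `E` at `x` with respect to the measure `μ`. -/
def lowerDensity (μ : Measure X) (E : Set X) (x : X) : ℝ≥0∞ :=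
  liminf (fun r : ℝ => μ (Metric.ball x r ∩ E) / μ (Metric.ball x r)) (𝓝[>] (0 : ℝ))

/-- The measure-theoretic boundary `∂*E`. -/
def measBdry (μ : Measure X) (E : Set X) : Set X :=
  {x | 0 < upperDensity μ E x ∧ 0 < upperDensity μ Eᶜ x}

/-- The set `Σ_β E` of points of the measure-theoretic boundary where both `E` and its
complement have lower density at least `β`. -/
def SigmaBeta (μ : Measure X) (β : ℝ≥0∞) (E : Set X) : Set X :=
  {x ∈ measBdry μ E | β ≤ lowerDensity μ E x ∧ β ≤ lowerDensity μ Eᶜ x}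

/-- The set `Σ E = ⋃_{β ∈ (0,1)} Σ_β E`. -/
def SigmaSet (μ : Measure X) (E : Set X) : Set X :=
  ⋃ β ∈ Set.Ioo (0 : ℝ≥0∞) 1, SigmaBeta μ β E

lemma ENNReal.pos_of_le_mul_rpow {a : ℝ} {b s t : ℝ≥0∞} (ha : 0 < a)
    (h : s ≤ b * t ^ a) (hs : 0 < s) : 0 < t := by
  rcases eq_or_ne t 0 with rfl | ht
  · rw [ENNReal.zero_rpow_of_pos ha, mul_zero] at h
    exact absurd hs h.not_gt
  · exact pos_iff_ne_zero.2 ht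

lemma mem_SigmaSet_iff {μ : Measure X} {E : Set X} {x : X} :
    x ∈ SigmaSet μ E ↔
      x ∈ measBdry μ E ∧ 0 < lowerDensity μ E x ∧ 0 < lowerDensity μ Eᶜ x := by
  simp only [SigmaSet, mem_iUnion, exists_prop]
  constructor
  · rintro ⟨β, hβ, hx, h₁, h₂⟩
    exact ⟨hx, hβ.1.trans_le h₁, hβ.1.trans_le h₂⟩
  · rintro ⟨hx, h₁, h₂⟩
    obtain ⟨β, hβ, hβ'⟩ := exists_between (lt_min (lt_min h₁ h₂) one_pos)
    have h := lt_min_iff.1 hβ'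
    exact ⟨β, ⟨hβ, h.2⟩, hx, (lt_min_iff.1 h.1).1.le, (lt_min_iff.1 h.1).2.le⟩

lemma mem_measBdry_of_mem_image {μX : Measure X} {μY : Measure Y} (f : X ≃ₜ Y)
    {a : ℝ} {b : ℝ≥0∞} (ha : 0 < a)
    (hup : ∀ E : Set X, MeasurableSet E → ∀ x : X,
      upperDensity μY (f '' E) (f x) ≤ b * upperDensity μX E x ^ a)
    {E : Set X} (hE : MeasurableSet E) {x : X} (hx : f x ∈ measBdry μY (f '' E)) :
    x ∈ measBdry μX E := by
  obtain ⟨h₁, h₂⟩ := hx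
  rw [← image_compl_eq f.bijective] at h₂
  exact ⟨ENNReal.pos_of_le_mul_rpow ha (hup E hE x) h₁,
    ENNReal.pos_of_le_mul_rpow ha (hup Eᶜ hE.compl x) h₂⟩

lemma mem_SigmaSet_of_mem_image {μX : Measure X} {μY : Measure Y} (f : X ≃ₜ Y)
    {a : ℝ} {b : ℝ≥0∞} (ha : 0 < a)
    (hup : ∀ E : Set X, MeasurableSet E → ∀ x : X,
      upperDensity μY (f '' E) (f x) ≤ b * upperDensity μX E x ^ a)
    (hlow : ∀ E : Set X, MeasurableSet E → ∀ x : X,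
      lowerDensity μY (f '' E) (f x) ≤ b * lowerDensity μX E x ^ a)
    {E : Set X} (hE : MeasurableSet E) {x : X} (hx : f x ∈ SigmaSet μY (f '' E)) :
    x ∈ SigmaSet μX E := by
  obtain ⟨hx, h₁, h₂⟩ := mem_SigmaSet_iff.1 hx
  rw [← image_compl_eq f.bijective] at h₂
  exact mem_SigmaSet_iff.2 ⟨mem_measBdry_of_mem_image f ha hup hE hx,
    ENNReal.pos_of_le_mul_rpow ha (hlow E hE x) h₁,
    ENNReal.pos_of_le_mul_rpow ha (hlow Eᶜ hE.compl x) h₂⟩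

/-- given the double-sided density estimates for `f` and `f⁻¹`, the essential
boundaries and measure-theoretic boundaries transform naturally under `f`. -/
theorem stmt4 (μX : Measure X) (μY : Measure Y)
    (hμX : ∀ (x : X) (r : ℝ), 0 < r → 0 < μX (Metric.ball x r) ∧ μX (Metric.ball x r) < ⊤)
    (hμY : ∀ (y : Y) (r : ℝ), 0 < r → 0 < μY (Metric.ball y r) ∧ μY (Metric.ball y r) < ⊤)
    (f : X ≃ₜ Y) {a a' : ℝ} {b b' : ℝ≥0} (ha : 0 < a) (hb : 0 < b) (ha' : 0 < a') (hb' : 0 < b')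
    (hup : ∀ E : Set X, MeasurableSet E → ∀ x : X,
      upperDensity μY (⇑f '' E) (f x) ≤ (b : ℝ≥0∞) * upperDensity μX E x ^ a)
    (hlow : ∀ E : Set X, MeasurableSet E → ∀ x : X,
      lowerDensity μY (⇑f '' E) (f x) ≤ (b : ℝ≥0∞) * lowerDensity μX E x ^ a)
    (hup' : ∀ F : Set Y, MeasurableSet F → ∀ y : Y,
      upperDensity μX (⇑f.symm '' F) (f.symm y) ≤ (b' : ℝ≥0∞) * upperDensity μY F y ^ a')
    (hlow' : ∀ F : Set Y, MeasurableSet F → ∀ y : Y,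
      lowerDensity μX (⇑f.symm '' F) (f.symm y) ≤ (b' : ℝ≥0∞) * lowerDensity μY F y ^ a')
    (E : Set X) (hE : MeasurableSet E) :
    (∀ β : ℝ≥0∞, β ∈ Set.Ioo (0 : ℝ≥0∞) 1 →
        SigmaBeta μY β (⇑f '' E) ⊆ ⇑f '' SigmaBeta μX ((β / b) ^ (1 / a)) E) ∧
      SigmaSet μY (⇑f '' E) = ⇑f '' SigmaSet μX E ∧
      measBdry μY (⇑f '' E) = ⇑f '' measBdry μX E := by
  have hfE : MeasurableSet (f '' E) := f.measurableEmbedding.measurableSet_image.2 hE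
  have hsymm : f.symm '' (f '' E) = E := by simp [image_image]
  have hpow : ∀ {β t : ℝ≥0∞}, β ≤ b * t ^ a → (β / b) ^ (1 / a) ≤ t := by
    intro β t h
    rw [one_div, ENNReal.rpow_inv_le_iff ha]
    exact ENNReal.div_le_of_le_mul' h
  refine ⟨fun β _ y hy => ?_, Subset.antisymm (fun y hy => ?_) ?_,
    Subset.antisymm (fun y hy => ?_) ?_⟩
  · obtain ⟨x, rfl⟩ := f.surjective y
    obtain ⟨hx, h₁, h₂⟩ := hy
    rw [← image_compl_eq f.bijective] at h₂
    exact ⟨x, ⟨mem_measBdry_of_mem_image f ha hup hE hx, hpow (h₁.trans (hlow E hE x)),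
      hpow (h₂.trans (hlow Eᶜ hE.compl x))⟩, rfl⟩
  · obtain ⟨x, rfl⟩ := f.surjective y
    exact ⟨x, mem_SigmaSet_of_mem_image f ha hup hlow hE hy, rfl⟩
  · rintro _ ⟨x, hx, rfl⟩
    refine mem_SigmaSet_of_mem_image f.symm ha' hup' hlow' hfE ?_
    rwa [hsymm, f.symm_apply_apply]
  · obtain ⟨x, rfl⟩ := f.surjective y
    exact ⟨x, mem_measBdry_of_mem_image f ha hup hE hy, rfl⟩
  · rintro _ ⟨x, hx, rfl⟩
    refine mem_measBdry_of_mem_image f.symm ha' hup' hfE ?_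
    rwa [hsymm, f.symm_apply_apply]
end
end

section
/- Let Q > 1 and let X be a metric space with a Borel measure μ that is Ahlfors Q-regular with constant C_A. Let E ⊆ X be a μ-measurable set, and let ν be a Borel measure on X such that the relative isoperimetric inequality min{μ(B(x,r)∩E), μ(B(x,r)\E)} ≤ C_I · r · ν(B(x,r)) holds for some constant C_I > 0, all x ∈ X, and all r > 0. If β ∈ (0,1] and x ∈ X is a point with liminf_{r→0⁺} μ(B(x,r)∩E)/μ(B(x,r)) ≥ β and liminf_{r→0⁺} μ(B(x,r)\E)/μ(B(x,r)) ≥ β, then liminf_{r→0⁺} ν(B(x,r))/r^{Q-1} ≥ β/(C_I·C_A). -/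
open Metric MeasureTheory Filter Topology ENNReal NNReal Set

noncomputable section

variable {X : Type*} [MetricSpace X] [MeasurableSpace X] [BorelSpace X]

/-- A measure `μ` on a metric space `X` (with at least two points) is Ahlfors `Q`-regular with
constant `C ≥ 1` if `r^Q/C ≤ μ(B(x,r)) ≤ C·r^Q` for every `x` and `0 < r < 2·diam X`. -/
def AhlforsRegular (X : Type*) [MetricSpace X] [MeasurableSpace X] (μ : Measure X)
    (Q : ℝ) (C : ℝ≥0) : Prop :=
  1 ≤ C ∧ ∀ (x : X) (r : ℝ), 0 < r → ENNReal.ofReal r < 2 * EMetric.diam (Set.univ : Set X) →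
    ENNReal.ofReal r ^ Q / C ≤ μ (Metric.ball x r) ∧
      μ (Metric.ball x r) ≤ C * ENNReal.ofReal r ^ Q

/-- lower bound on the `(Q-1)`-codimensional lower density of `ν` at a point
where `E` and its complement both have lower density at least `β`, given a relative
isoperimetric inequality relating `μ` and `ν`. -/
theorem stmt5 {Q : ℝ} (hQ : 1 < Q) [Nontrivial X] {C_A : ℝ≥0}
    (μ ν : Measure X) (hA : AhlforsRegular X μ Q C_A)
    (E : Set X) (hE : NullMeasurableSet E μ)
    {C_I : ℝ} (hCI : 0 < C_I)
    (hiso : ∀ (x : X) (r : ℝ), 0 < r →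
      min (μ (Metric.ball x r ∩ E)) (μ (Metric.ball x r \ E)) ≤
        ENNReal.ofReal (C_I * r) * ν (Metric.ball x r))
    {β : ℝ} (hβ : β ∈ Set.Ioc (0 : ℝ) 1) (x : X)
    (h1 : ENNReal.ofReal β ≤
      liminf (fun r : ℝ => μ (Metric.ball x r ∩ E) / μ (Metric.ball x r)) (𝓝[>] (0 : ℝ)))
    (h2 : ENNReal.ofReal β ≤
      liminf (fun r : ℝ => μ (Metric.ball x r \ E) / μ (Metric.ball x r)) (𝓝[>] (0 : ℝ))) :
    ENNReal.ofReal (β / (C_I * C_A)) ≤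
      liminf (fun r : ℝ => ν (Metric.ball x r) / ENNReal.ofReal r ^ (Q - 1))
        (𝓝[>] (0 : ℝ)) := by
  obtain ⟨hC1, hreg⟩ := hA
  have hC0 : (C_A : ℝ≥0∞) ≠ 0 := by
    exact_mod_cast (zero_lt_one.trans_le hC1).ne'
  have hI0 : ENNReal.ofReal C_I ≠ 0 := by simpa using hCI
  have hK0 : ENNReal.ofReal C_I * (C_A : ℝ≥0∞) ≠ 0 := mul_ne_zero hI0 hC0
  have hKtop : ENNReal.ofReal C_I * (C_A : ℝ≥0∞) ≠ ∞ :=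
    ENNReal.mul_ne_top ofReal_ne_top coe_ne_top
  have hCpos : (0 : ℝ) < C_A := by exact_mod_cast zero_lt_one.trans_le hC1
  rw [ENNReal.ofReal_div_of_pos (mul_pos hCI hCpos), ENNReal.ofReal_mul hCI.le,
    ENNReal.ofReal_coe_nnreal]
  refine le_of_forall_lt fun a ha => ?_
  obtain ⟨b, hab, hb⟩ := exists_between ha
  refine hab.trans_le (le_liminf_of_le (by isBoundedDefault) ?_)
  have hc : b * (ENNReal.ofReal C_I * C_A) < ENNReal.ofReal β :=
    (ENNReal.lt_div_iff_mul_lt (Or.inl hK0) (Or.inl hKtop)).1 hb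
  have hdiam : (0 : ℝ≥0∞) < 2 * EMetric.diam (Set.univ : Set X) :=
    ENNReal.mul_pos two_ne_zero (ediam_pos_iff.2 nontrivial_univ).ne'
  have hsmall : ∀ᶠ r : ℝ in 𝓝[>] (0 : ℝ),
      ENNReal.ofReal r < 2 * EMetric.diam (Set.univ : Set X) := by
    refine nhdsWithin_le_nhds ?_
    have := (ENNReal.continuous_ofReal.tendsto 0)
    rw [ENNReal.ofReal_zero] at this
    exact this.eventually_lt_const hdiam
  filter_upwards [eventually_lt_of_lt_liminf (hc.trans_le h1),
    eventually_lt_of_lt_liminf (hc.trans_le h2), hsmall, self_mem_nhdsWithin]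
    with r hr1 hr2 hr3 (hr : 0 < r)
  have hr0 : ENNReal.ofReal r ≠ 0 := by simpa using hr
  have hpow0 : ENNReal.ofReal r ^ (Q - 1) ≠ 0 :=
    (ENNReal.rpow_pos (ENNReal.ofReal_pos.2 hr) ofReal_ne_top).ne'
  have hpowtop : ENNReal.ofReal r ^ (Q - 1) ≠ ∞ :=
    ENNReal.rpow_ne_top_of_nonneg (by linarith) ofReal_ne_top
  rw [ENNReal.le_div_iff_mul_le (Or.inl hpow0) (Or.inl hpowtop)]
  have hmul0 : ENNReal.ofReal (C_I * r) ≠ 0 := by simpa using mul_pos hCI hr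
  refine (ENNReal.mul_le_mul_iff_right hmul0 ofReal_ne_top).1 ?_
  have hsplit : ENNReal.ofReal r ^ Q = ENNReal.ofReal r * ENNReal.ofReal r ^ (Q - 1) := by
    conv_rhs => rw [← ENNReal.rpow_one (ENNReal.ofReal r), ← ENNReal.rpow_mul, one_mul]
    rw [← ENNReal.rpow_add _ _ hr0 ofReal_ne_top, add_sub_cancel]
  calc ENNReal.ofReal (C_I * r) * (b * ENNReal.ofReal r ^ (Q - 1))
      = b * ENNReal.ofReal C_I * (C_A * (ENNReal.ofReal r ^ Q / C_A)) := by
        rw [ENNReal.mul_div_cancel hC0 coe_ne_top, hsplit, ENNReal.ofReal_mul hCI.le]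
        ring
    _ = b * (ENNReal.ofReal C_I * C_A) * (ENNReal.ofReal r ^ Q / C_A) := by ring
    _ ≤ b * (ENNReal.ofReal C_I * C_A) * μ (Metric.ball x r) := by
        gcongr
        exact (hreg x r hr hr3).1
    _ ≤ min (μ (Metric.ball x r ∩ E)) (μ (Metric.ball x r \ E)) :=
        le_min (ENNReal.mul_le_of_le_div hr1.le) (ENNReal.mul_le_of_le_div hr2.le)
    _ ≤ ENNReal.ofReal (C_I * r) * ν (Metric.ball x r) := hiso x r hr
end
end

section
/- (Ziemer's lemma.) Let X be a metric space equipped with a Borel measure μ, let 1 < p < ∞, and let (L_i)_{i∈ℕ} be a sequence of collections of Borel measures on X such that L_i ⊆ L_{i+1} for each i. Then Mod_p(⋃_{i∈ℕ} L_i) = lim_{i→∞} Mod_p(L_i). -/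
open Metric MeasureTheory Filter Topology ENNReal NNReal Set

noncomputable section

variable {X : Type*} [MetricSpace X] [MeasurableSpace X] [BorelSpace X]

/-- The `p`-modulus of a collection `M` of (Borel) measures on `X`, with base measure `μ`:
the infimum of `∫ ρ^p dμ` over all Borel functions `ρ : X → [0,∞]` with `∫ ρ dλ ≥ 1` for
every `λ ∈ M`. -/
def Modp (μ : Measure X) (p : ℝ) (M : Set (Measure X)) : ℝ≥0∞ :=
  ⨅ ρ ∈ {ρ : X → ℝ≥0∞ | Measurable ρ ∧ ∀ lam ∈ M, 1 ≤ ∫⁻ x, ρ x ∂lam},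
    ∫⁻ x, ρ x ^ p ∂μ

/-- Uniform strict convexity of `t ↦ t ^ p` on `[0, 1]` against the endpoint `1`. -/
theorem exists_one_sub_rpow_le {p : ℝ} (hp : 1 < p) {ε : ℝ} (hε : 0 < ε) :
    ∃ C : ℝ, 0 ≤ C ∧ ∀ t : ℝ, 0 ≤ t → t ≤ 1 →
      (1 - t) ^ p ≤ ε + C * ((t ^ p + 1) / 2 - ((t + 1) / 2) ^ p) := by
  have hp0 : 0 ≤ p := by linarith
  have hpos : ∀ t : ℝ, 0 ≤ t → t ≠ 1 → 0 < (t ^ p + 1) / 2 - ((t + 1) / 2) ^ p := by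
    intro t ht ht1
    have h := (strictConvexOn_rpow hp).2 (mem_Ici.2 ht) (mem_Ici.2 zero_le_one) ht1
      (one_half_pos (α := ℝ)) one_half_pos (add_halves 1)
    simp only [smul_eq_mul, Real.one_rpow, mul_one] at h
    rw [show (t + 1) / 2 = 1 / 2 * t + 1 / 2 by ring]
    linarith
  have hcont : Continuous fun t : ℝ => (1 - t) ^ p :=
    (Real.continuous_rpow_const hp0).comp (continuous_const.sub continuous_id)
  have hK : IsCompact (Icc (0 : ℝ) 1 ∩ {t | ε ≤ (1 - t) ^ p}) :=
    isCompact_Icc.inter_right (isClosed_le continuous_const hcont)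
  have hφ : Continuous fun t : ℝ => (t ^ p + 1) / 2 - ((t + 1) / 2) ^ p :=
    (((Real.continuous_rpow_const hp0).add continuous_const).div_const 2).sub
      ((Real.continuous_rpow_const hp0).comp ((continuous_id.add continuous_const).div_const 2))
  obtain ⟨δ, hδ, hδle⟩ := hK.exists_forall_le' hφ.continuousOn (a := 0) (by
    rintro t ⟨⟨ht0, -⟩, ht⟩
    refine hpos t ht0 ?_
    rintro rfl
    rw [mem_ofPred_eq, sub_self, Real.zero_rpow (by linarith)] at ht
    linarith)
  refine ⟨δ⁻¹, by positivity, fun t ht0 ht1 => ?_⟩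
  by_cases ht : ε ≤ (1 - t) ^ p
  · have h1 : (1 - t) ^ p ≤ 1 := Real.rpow_le_one (by linarith) (by linarith) hp0
    have h2 : 1 ≤ δ⁻¹ * ((t ^ p + 1) / 2 - ((t + 1) / 2) ^ p) := by
      rw [← div_eq_inv_mul, one_le_div hδ]
      exact hδle t ⟨⟨ht0, ht1⟩, ht⟩
    linarith
  · have h2 : 0 ≤ (t ^ p + 1) / 2 - ((t + 1) / 2) ^ p := by
      rcases eq_or_ne t 1 with rfl | h
      · norm_num
      · exact (hpos t ht0 h).le
    have : 0 ≤ δ⁻¹ * ((t ^ p + 1) / 2 - ((t + 1) / 2) ^ p) := by positivity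
    linarith

/-- A pointwise uniform convexity inequality for `t ↦ t ^ p` on `[0, ∞]`. -/
theorem exists_tsub_rpow_add_le {p : ℝ} (hp : 1 < p) {ε : ℝ≥0} (hε : 0 < ε) :
    ∃ C : ℝ≥0, ∀ a b : ℝ≥0∞,
      (b - a) ^ p + C * ((a + b) / 2) ^ p ≤ ε * (a ^ p + b ^ p) + C * ((a ^ p + b ^ p) / 2) := by
  have hp0 : 0 < p := by linarith
  obtain ⟨C, hC0, hC⟩ := exists_one_sub_rpow_le hp (ε := ε) (by exact_mod_cast hε)
  lift C to ℝ≥0 using hC0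
  refine ⟨C, fun a b => ?_⟩
  rcases le_total b a with hba | hab
  · rw [tsub_eq_zero_of_le hba, ENNReal.zero_rpow_of_pos hp0, zero_add]
    have h := ENNReal.rpow_arith_mean_le_arith_mean2_rpow 2⁻¹ 2⁻¹ a b
      (ENNReal.inv_two_add_inv_two) hp.le
    rw [← mul_add, ← mul_add, mul_comm, ← div_eq_mul_inv, mul_comm (2⁻¹ : ℝ≥0∞),
      ← div_eq_mul_inv] at h
    exact le_add_left (mul_le_mul_right h _)
  · rcases eq_or_ne b ∞ with rfl | hb
    · rw [ENNReal.top_rpow_of_pos hp0, add_top (a ^ p),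
        ENNReal.mul_top (ENNReal.coe_ne_zero.2 hε.ne'),
        top_add]
      exact le_top
    lift a to ℝ≥0 using ne_top_of_le_ne_top hb hab
    lift b to ℝ≥0 using hb
    norm_cast at hab
    rcases eq_or_ne b 0 with rfl | hb0
    · obtain rfl : a = 0 := le_antisymm hab zero_le
      simp [ENNReal.zero_rpow_of_pos hp0]
    have hb : (0 : ℝ) < b := by exact_mod_cast pos_iff_ne_zero.2 hb0
    have hab' : (a : ℝ) ≤ b := by exact_mod_cast hab
    have h := hC (a / b) (by positivity) ((div_le_one hb).2 hab')
    rw [one_sub_div hb.ne', div_add_one hb.ne', div_right_comm, Real.div_rpow (by linarith) hb.le,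
      Real.div_rpow (by positivity) hb.le, Real.div_rpow (by positivity) hb.le] at h
    have hbp : (0 : ℝ) < (b : ℝ) ^ p := by positivity
    have hap : (0 : ℝ) ≤ (a : ℝ) ^ p := by positivity
    have key : ((b : ℝ) - a) ^ p + C * (((a : ℝ) + b) / 2) ^ p
        ≤ ε * ((a : ℝ) ^ p + (b : ℝ) ^ p) + C * (((a : ℝ) ^ p + (b : ℝ) ^ p) / 2) := by
      have h' := mul_le_mul_of_nonneg_right h hbp.le
      field_simp at h'
      have : 0 ≤ (ε : ℝ) * (a : ℝ) ^ p := by positivity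
      field_simp
      nlinarith
    rw [← ENNReal.coe_sub, ← ENNReal.coe_add, ← ENNReal.coe_two, ← ENNReal.coe_div two_ne_zero,
      ← ENNReal.coe_rpow_of_nonneg _ hp0.le, ← ENNReal.coe_rpow_of_nonneg _ hp0.le,
      ← ENNReal.coe_rpow_of_nonneg _ hp0.le, ← ENNReal.coe_rpow_of_nonneg _ hp0.le,
      ← ENNReal.coe_add, ← ENNReal.coe_div two_ne_zero]
    exact_mod_cast key

theorem modp_mono {α : Type*} [MeasurableSpace α] (μ : Measure α) (p : ℝ) :
    Monotone (Modp μ p) := fun _ _ h =>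
  biInf_mono fun _ hρ => ⟨hρ.1, fun lam hlam => hρ.2 lam (h hlam)⟩

theorem modp_le {α : Type*} [MeasurableSpace α] (μ : Measure α) (p : ℝ)
    {M : Set (Measure α)} {ρ : α → ℝ≥0∞}
    (hρ : Measurable ρ) (h : ∀ lam ∈ M, 1 ≤ ∫⁻ x, ρ x ∂lam) :
    Modp μ p M ≤ ∫⁻ x, ρ x ^ p ∂μ :=
  iInf₂_le ρ ⟨hρ, h⟩

/-- The midpoint of two admissible functions is admissible. -/
theorem modp_le_midpoint {α : Type*} [MeasurableSpace α] (μ : Measure α) (p : ℝ)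
    {M : Set (Measure α)} {f g : α → ℝ≥0∞}
    (hf : Measurable f) (hg : Measurable g) (hfM : ∀ lam ∈ M, 1 ≤ ∫⁻ x, f x ∂lam)
    (hgM : ∀ lam ∈ M, 1 ≤ ∫⁻ x, g x ∂lam) :
    Modp μ p M ≤ ∫⁻ x, ((f x + g x) / 2) ^ p ∂μ := by
  refine modp_le μ p ((hf.add hg).div_const 2) fun lam hlam => ?_
  simp only [div_eq_mul_inv]
  rw [lintegral_mul_const _ (by fun_prop), lintegral_add_left hf, ← div_eq_mul_inv,
    ENNReal.le_div_iff_mul_le (by simp) (by simp), one_mul, ← one_add_one_eq_two]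
  exact add_le_add (hfM lam hlam) (hgM lam hlam)

theorem lintegral_tsub_rpow_add_modp_le {α : Type*} [MeasurableSpace α] (μ : Measure α) {p : ℝ}
    {ε C : ℝ≥0}
    (hC : ∀ a b : ℝ≥0∞,
      (b - a) ^ p + C * ((a + b) / 2) ^ p ≤ ε * (a ^ p + b ^ p) + C * ((a ^ p + b ^ p) / 2))
    {M : Set (Measure α)} {f g : α → ℝ≥0∞} (hf : Measurable f) (hg : Measurable g)
    (hfM : ∀ lam ∈ M, 1 ≤ ∫⁻ x, f x ∂lam) (hgM : ∀ lam ∈ M, 1 ≤ ∫⁻ x, g x ∂lam)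
    {B : ℝ≥0∞} (hfB : ∫⁻ x, f x ^ p ∂μ ≤ B) (hgB : ∫⁻ x, g x ^ p ∂μ ≤ B) :
    ∫⁻ x, (g x - f x) ^ p ∂μ + C * Modp μ p M ≤ ε * (2 * B) + C * B := by
  have hfp := hf.pow_const p
  have hs : ∫⁻ x, (f x ^ p + g x ^ p) ∂μ ≤ 2 * B := by
    rw [lintegral_add_left hfp, two_mul]
    exact add_le_add hfB hgB
  calc ∫⁻ x, (g x - f x) ^ p ∂μ + C * Modp μ p M
      ≤ ∫⁻ x, (g x - f x) ^ p ∂μ + C * ∫⁻ x, ((f x + g x) / 2) ^ p ∂μ := by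
        gcongr
        exact modp_le_midpoint μ p hf hg hfM hgM
    _ = ∫⁻ x, ((g x - f x) ^ p + C * ((f x + g x) / 2) ^ p) ∂μ := by
        rw [lintegral_add_left (by fun_prop),
          lintegral_const_mul _ (by fun_prop)]
    _ ≤ ∫⁻ x, (ε * (f x ^ p + g x ^ p) + C * ((f x ^ p + g x ^ p) / 2)) ∂μ :=
        lintegral_mono fun x => hC _ _
    _ = ε * ∫⁻ x, (f x ^ p + g x ^ p) ∂μ + C * ((∫⁻ x, (f x ^ p + g x ^ p) ∂μ) / 2) := by
        simp only [div_eq_mul_inv]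
        rw [lintegral_add_left (by fun_prop), lintegral_const_mul _ (by fun_prop),
          lintegral_const_mul _ (by fun_prop), lintegral_mul_const _ (by fun_prop)]
    _ ≤ ε * (2 * B) + C * (2 * B / 2) := by gcongr
    _ = ε * (2 * B) + C * B := by
        rw [mul_comm 2 B, ENNReal.mul_div_cancel_right two_ne_zero ofNat_ne_top]

/-- Almost minimal admissible functions for an increasing sequence of families form a
Cauchy sequence in `L^p`. -/
theorem eventually_lintegral_tsub_rpow_le {α : Type*} [MeasurableSpace α] (μ : Measure α) {p : ℝ}
    (hp : 1 < p)
    {L : ℕ → Set (Measure α)} (hL : Monotone L) {ρ : ℕ → α → ℝ≥0∞}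
    (hρ : ∀ i, Measurable (ρ i)) (hρL : ∀ i, ∀ lam ∈ L i, 1 ≤ ∫⁻ x, ρ i x ∂lam)
    {c : ℝ≥0∞} (hc : c ≠ ∞) (hLc : Tendsto (fun i => Modp μ p (L i)) atTop (𝓝 c))
    {e : ℕ → ℝ≥0∞} (he : Antitone e) (he0 : Tendsto e atTop (𝓝 0))
    (hρc : ∀ i, ∫⁻ x, ρ i x ^ p ∂μ ≤ c + e i) {η : ℝ≥0∞} (hη : η ≠ 0) :
    ∀ᶠ N in atTop, ∀ i ≥ N, ∀ j ≥ N, ∫⁻ x, (ρ j x - ρ i x) ^ p ∂μ ≤ η := by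
  obtain ⟨ε, hε, hεη⟩ : ∃ ε : ℝ≥0, 0 < ε ∧ ε * (2 * c) < η :=
    ENNReal.exists_nnreal_pos_mul_lt (by finiteness) hη
  obtain ⟨C, hC⟩ := exists_tsub_rpow_add_le hp hε
  have hce : Tendsto (fun N => c + e N) atTop (𝓝 c) := by
    simpa using tendsto_const_nhds.add he0
  have hlim : Tendsto (fun N => ε * (2 * (c + e N)) + C * (c + e N) - C * Modp μ p (L N)) atTop
      (𝓝 (ε * (2 * c) + C * c - C * c)) := by
    refine ENNReal.Tendsto.sub (.add ?_ ?_) ?_ (.inr (by finiteness))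
    · exact ENNReal.Tendsto.const_mul (ENNReal.Tendsto.const_mul hce (.inr (by simp)))
        (.inr (by simp))
    · exact ENNReal.Tendsto.const_mul hce (.inr (by simp))
    · exact ENNReal.Tendsto.const_mul hLc (.inr (by simp))
  rw [ENNReal.add_sub_cancel_right (by finiteness)] at hlim
  filter_upwards [hlim.eventually_lt_const hεη, hLc.eventually_lt_const hc.lt_top]
    with N hN hNc i hi j hj
  refine le_trans (ENNReal.le_sub_of_add_le_right (by finiteness) ?_) hN.le
  have hadm : ∀ k ≥ N, ∀ lam ∈ L N, 1 ≤ ∫⁻ x, ρ k x ∂lam :=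
    fun k hk lam hlam => hρL k lam (hL hk hlam)
  have hB : ∀ k ≥ N, ∫⁻ x, ρ k x ^ p ∂μ ≤ c + e N :=
    fun k hk => (hρc k).trans (by gcongr; exact he hk)
  exact lintegral_tsub_rpow_add_modp_le μ hC (hρ i) (hρ j) (hadm i hi) (hadm j hj) (hB i hi)
    (hB j hj)

/-- A sequence with `L^p`-summable positive increments has an `L^p`-controlled majorant. -/
theorem exists_forall_le_lintegral_rpow_le {α : Type*} [MeasurableSpace α] (μ : Measure α) {p : ℝ}
    (hp : 1 ≤ p)
    {f : ℕ → α → ℝ≥0∞} (hf : ∀ n, Measurable (f n)) {b : ℕ → ℝ≥0∞}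
    (hb : ∀ n, ∫⁻ x, (f (n + 1) x - f n x) ^ p ∂μ ≤ b n ^ p) :
    ∃ F : α → ℝ≥0∞, Measurable F ∧ (∀ n x, f n x ≤ F x) ∧
      (∫⁻ x, F x ^ p ∂μ) ^ (1 / p) ≤ (∫⁻ x, f 0 x ^ p ∂μ) ^ (1 / p) + ∑' n, b n := by
  have hp0 : 0 < p := by linarith
  let F : ℕ → α → ℝ≥0∞ := fun n x => f 0 x + ∑ k ∈ Finset.range n, (f (k + 1) x - f k x)
  have hFs : ∀ n x, F (n + 1) x = F n x + (f (n + 1) x - f n x) := fun n x => by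
    simp only [F, Finset.sum_range_succ, add_assoc]
  have hFm : ∀ n, Measurable (F n) := fun n =>
    (hf 0).add (Finset.measurable_fun_sum _ fun k _ => (hf (k + 1)).sub (hf k))
  have hFmono : Monotone F := monotone_nat_of_le_succ fun n x => by
    rw [hFs]; exact le_self_add
  have hfF : ∀ n x, f n x ≤ F n x := by
    intro n x
    induction n with
    | zero => simp [F]
    | succ n ih =>
      rw [hFs]
      exact le_add_tsub.trans (by gcongr)
  have hnorm : ∀ n, (∫⁻ x, F n x ^ p ∂μ) ^ (1 / p) ≤
      (∫⁻ x, f 0 x ^ p ∂μ) ^ (1 / p) + ∑ k ∈ Finset.range n, b k := by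
    intro n
    induction n with
    | zero => simp [F]
    | succ n ih =>
      rw [Finset.sum_range_succ, ← add_assoc]
      simp only [hFs]
      refine (ENNReal.lintegral_Lp_add_le (hFm n).aemeasurable
        ((hf (n + 1)).sub (hf n)).aemeasurable hp).trans (add_le_add ih ?_)
      rw [one_div, ENNReal.rpow_inv_le_iff hp0]
      exact hb n
  refine ⟨fun x => ⨆ n, F n x, .iSup hFm, fun n x => (hfF n x).trans (le_iSup (F · x) n), ?_⟩
  have hsup : ∫⁻ x, (⨆ n, F n x) ^ p ∂μ = ⨆ n, ∫⁻ x, F n x ^ p ∂μ := by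
    rw [← lintegral_iSup (fun n => (hFm n).pow_const p)
      fun m n h x => ENNReal.rpow_le_rpow (hFmono h x) hp0.le]
    exact lintegral_congr fun x => (ENNReal.orderIsoRpow p hp0).map_iSup _
  rw [hsup, one_div, ENNReal.rpow_inv_le_iff hp0]
  refine iSup_le fun n => ?_
  rw [← ENNReal.rpow_inv_le_iff hp0, ← one_div]
  exact (hnorm n).trans (by gcongr; exact ENNReal.sum_le_tsum _)

theorem modp_iUnion_rpow_le {α : Type*} [MeasurableSpace α] (μ : Measure α) {p : ℝ}
    (hp : 1 < p)
    {L : ℕ → Set (Measure α)} (hL : Monotone L) {c : ℝ≥0∞} (hc : c ≠ ∞)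
    (hLc : Tendsto (fun i => Modp μ p (L i)) atTop (𝓝 c)) {η : ℝ≥0} (hη : 0 < η) :
    Modp μ p (⋃ i, L i) ^ (1 / p) ≤ (c + η) ^ (1 / p) + η := by
  have hp0 : 0 < p := by linarith
  have hmono : Monotone fun i => Modp μ p (L i) := (modp_mono μ p).comp hL
  let e : ℕ → ℝ≥0∞ := fun i => (i : ℝ≥0∞)⁻¹
  have he0 : Tendsto e atTop (𝓝 0) := ENNReal.tendsto_inv_nat_nhds_zero
  have hex : ∀ i, ∃ ρ : α → ℝ≥0∞, Measurable ρ ∧ (∀ lam ∈ L i, 1 ≤ ∫⁻ x, ρ x ∂lam) ∧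
      ∫⁻ x, ρ x ^ p ∂μ ≤ c + e i := by
    intro i
    have hle : Modp μ p (L i) ≤ c := hmono.ge_of_tendsto hLc i
    have hlt : Modp μ p (L i) < c + e i :=
      hle.trans_lt (ENNReal.lt_add_right hc (by simp [e]))
    obtain ⟨ρ, hlt⟩ := iInf_lt_iff.1 hlt
    obtain ⟨hρ, h⟩ := iInf_lt_iff.1 hlt
    exact ⟨ρ, hρ.1, hρ.2, h.le⟩
  choose ρ hρ hρL hρc using hex
  obtain ⟨b, hb0, hb⟩ := ENNReal.exists_pos_sum_of_countable (ENNReal.coe_ne_zero.2 hη.ne') ℕ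
  have hcauchy : ∀ n : ℕ, ∀ᶠ N in atTop,
      (∀ i ≥ N, ∀ j ≥ N, ∫⁻ x, (ρ j x - ρ i x) ^ p ∂μ ≤ (b n : ℝ≥0∞) ^ p) ∧ e N ≤ η := by
    intro n
    refine (eventually_lintegral_tsub_rpow_le μ hp hL hρ hρL hc hLc ?_ he0 hρc ?_).and
      (he0.eventually_le_const (by exact_mod_cast hη))
    · exact fun i j h => ENNReal.inv_le_inv.2 (by exact_mod_cast h)
    · simp [ENNReal.rpow_eq_zero_iff, (hb0 n).ne']
  obtain ⟨φ, hφ, hφe⟩ := extraction_forall_of_eventually hcauchy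
  obtain ⟨F, hFm, hF, hFp⟩ := exists_forall_le_lintegral_rpow_le μ hp.le
    (fun n => hρ (φ n)) (b := fun n => (b n : ℝ≥0∞))
    fun n => (hφe n).1 _ le_rfl _ (hφ n.lt_succ_self).le
  have hadm : ∀ lam ∈ ⋃ i, L i, 1 ≤ ∫⁻ x, F x ∂lam := by
    intro lam hlam
    obtain ⟨i, hi⟩ := mem_iUnion.1 hlam
    exact (hρL (φ i) lam (hL (hφ.id_le i) hi)).trans (lintegral_mono (hF i))
  calc Modp μ p (⋃ i, L i) ^ (1 / p)
      ≤ (∫⁻ x, F x ^ p ∂μ) ^ (1 / p) := by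
        gcongr
        exact modp_le μ p hFm hadm
    _ ≤ (∫⁻ x, ρ (φ 0) x ^ p ∂μ) ^ (1 / p) + ∑' n, (b n : ℝ≥0∞) := hFp
    _ ≤ (c + η) ^ (1 / p) + η := by
        gcongr
        exact (hρc _).trans (by gcongr; exact (hφe 0).2)

/-- Ziemer's lemma: for an increasing sequence of families of measures,
`Mod_p(⋃ᵢ Lᵢ) = limᵢ Mod_p(Lᵢ)`. -/
theorem stmt6 (μ : Measure X) {p : ℝ} (hp1 : 1 < p)
    (L : ℕ → Set (Measure X)) (hL : ∀ i, L i ⊆ L (i + 1)) :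
    Tendsto (fun i => Modp μ p (L i)) atTop (𝓝 (Modp μ p (⋃ i, L i))) := by
  have hp0 : 0 < p := by linarith
  have hLmono : Monotone L := monotone_nat_of_le_succ hL
  have hlim : Tendsto (fun i => Modp μ p (L i)) atTop (𝓝 (⨆ i, Modp μ p (L i))) :=
    tendsto_atTop_iSup ((modp_mono μ p).comp hLmono)
  set c := ⨆ i, Modp μ p (L i)
  have hle : c ≤ Modp μ p (⋃ i, L i) := iSup_le fun i => modp_mono μ p (subset_iUnion L i)
  suffices h : Modp μ p (⋃ i, L i) ≤ c by rwa [le_antisymm h hle]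
  rcases eq_or_ne c ∞ with hc | hc
  · exact hc ▸ le_top
  have hcont : Tendsto (fun η : ℝ≥0 => (c + η) ^ (1 / p) + (η : ℝ≥0∞)) (𝓝[>] 0)
      (𝓝 (c ^ (1 / p))) := by
    have : Continuous fun η : ℝ≥0 => (c + η) ^ (1 / p) + (η : ℝ≥0∞) :=
      (ENNReal.continuous_rpow_const.comp (continuous_const.add ENNReal.continuous_coe)).add
        ENNReal.continuous_coe
    simpa using (this.tendsto 0).mono_left nhdsWithin_le_nhds
  rw [← ENNReal.rpow_le_rpow_iff (z := 1 / p) (by positivity)]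
  exact ge_of_tendsto hcont (eventually_mem_nhdsWithin.mono fun η hη =>
    modp_iUnion_rpow_le μ hp1 hLmono hc hlim hη)
end
end

section
/- Let X and Y be metric spaces and let f : X → Y satisfy the η-quasisymmetry condition. For n, m ∈ ℕ let A_{n,m} = {x ∈ X : r/m ≤ L_f(x,r) ≤ m·r for all 0 < r < 1/n}. Then for all x, y ∈ A_{n,m} with d_X(x,y) < 1/n one has d_X(x,y)/(η(1)·m) ≤ d_Y(f(x),f(y)) ≤ m·d_X(x,y); in particular f is biLipschitz on A_{n,m} at scales below 1/n. -/
open Metric MeasureTheory Filter Topology ENNReal NNReal Set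

noncomputable section

variable {X Y : Type*} [MetricSpace X] [MetricSpace Y]

/-- `L_f(x,r)`: the supremum of the distances `d_Y(f x, f y)` over `y` in the
closed ball `B̄(x,r)`, taken in `[0,∞]`. -/
def Lfr (f : X → Y) (x : X) (r : ℝ) : ℝ≥0∞ :=
  ⨆ y ∈ Metric.closedBall x r, edist (f x) (f y)

/-- The set `A_{n,m} = {x : r/m ≤ L_f(x,r) ≤ m·r for all 0 < r < 1/n}`. -/
def Anm (f : X → Y) (n m : ℕ) : Set X :=
  {x | ∀ r : ℝ, 0 < r → r < 1 / (n : ℝ) →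
    ENNReal.ofReal (r / (m : ℝ)) ≤ Lfr f x r ∧ Lfr f x r ≤ ENNReal.ofReal ((m : ℝ) * r)}

lemma edist_le_Lfr (f : X → Y) {x y : X} {r : ℝ} (h : dist x y ≤ r) :
    edist (f x) (f y) ≤ Lfr f x r :=
  le_iSup₂_of_le y (by rwa [mem_closedBall, dist_comm]) le_rfl

/-- On `A_{n,m}`, the map `f` is `m`-Lipschitz from the base point at scales below `1/n`. -/
lemma dist_le_of_mem_Anm {f : X → Y} {n m : ℕ} {x y : X} (hx : x ∈ Anm f n m)
    (hxy : dist x y < 1 / (n : ℝ)) : dist (f x) (f y) ≤ (m : ℝ) * dist x y := by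
  rcases eq_or_ne x y with rfl | hne
  · simp
  · have h := (edist_le_Lfr f le_rfl).trans (hx _ (dist_pos.2 hne) hxy).2
    rw [edist_dist] at h
    exact (ENNReal.ofReal_le_ofReal_iff (by positivity)).1 h

lemma continuousAt_of_mem_Anm {f : X → Y} {n m : ℕ} (hn : 0 < n) {x : X}
    (hx : x ∈ Anm f n m) : ContinuousAt f x := by
  have hlim : Tendsto (fun z ↦ (m : ℝ) * dist x z) (𝓝 x) (𝓝 0) := by
    have : Continuous fun z ↦ (m : ℝ) * dist x z := by fun_prop
    simpa using this.tendsto x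
  refine tendsto_iff_dist_tendsto_zero.2
    (squeeze_zero' (Eventually.of_forall fun _ ↦ dist_nonneg) ?_ hlim)
  filter_upwards [ball_mem_nhds x (show (0 : ℝ) < 1 / n by positivity)] with z hz
  rw [dist_comm]
  exact dist_le_of_mem_Anm hx (by rwa [dist_comm])

/-- Points of `A_{n,m}` are not isolated. -/
lemma neBot_nhdsNE_of_mem_Anm {f : X → Y} {n m : ℕ} (hn : 0 < n) (hm : 0 < m) {x : X}
    (hx : x ∈ Anm f n m) : (𝓝[≠] x).NeBot := by
  rw [← mem_closure_iff_nhdsWithin_neBot, Metric.mem_closure_iff]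
  intro ε hε
  by_contra! hcon
  have hn' : (0 : ℝ) < 1 / n := by positivity
  obtain ⟨r, hr, hr'⟩ := exists_between (lt_min hε hn')
  have hL : Lfr f x r = 0 := by
    simp only [Lfr, ENNReal.iSup_eq_zero]
    intro z hz
    have : z = x := by
      by_contra hzx
      have h := hcon z hzx
      rw [mem_closedBall, dist_comm] at hz
      linarith [min_le_left ε (1 / (n : ℝ))]
    simp [this]
  have h := (hx r hr (hr'.trans_le (min_le_right _ _))).1
  rw [hL, nonpos_iff_eq_zero, ENNReal.ofReal_eq_zero] at h
  have : 0 < r / m := by positivity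
  linarith

/-- If `f` is continuous at a non-isolated point `y ≠ x`, then the quasisymmetry condition with
`t = 1` extends to the degenerate triple `(x, y, y)`. -/
lemma IsQuasisymmetric.nndist_le_self {η : ℝ≥0 ≃ₜ ℝ≥0} {f : X → Y} (hf : IsQuasisymmetric η f)
    {x y : X} (hne : x ≠ y) (hy : (𝓝[≠] y).NeBot) (hc : ContinuousAt f y) :
    nndist (f x) (f y) ≤ η 1 * nndist (f x) (f y) := by
  have hpos : nndist x y ≠ 0 := by simpa using hne
  have hl : Tendsto (fun z ↦ nndist (f x) (f z)) (𝓝[≠] y) (𝓝 (nndist (f x) (f y))) :=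
    (tendsto_const_nhds.nndist hc).mono_left nhdsWithin_le_nhds
  have hr : Tendsto (fun z ↦ η (nndist x z / nndist x y) * nndist (f x) (f y)) (𝓝[≠] y)
      (𝓝 (η 1 * nndist (f x) (f y))) := by
    have : Continuous fun z ↦ η (nndist x z / nndist x y) * nndist (f x) (f y) := by
      have h : Continuous fun z ↦ nndist x z / nndist x y :=
        (continuous_const.nndist continuous_id).div_const _
      exact (η.continuous.comp h).mul continuous_const
    have h := this.tendsto y
    rw [div_self hpos] at h
    exact h.mono_left nhdsWithin_le_nhds
  refine le_of_tendsto_of_tendsto hl hr ?_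
  filter_upwards [self_mem_nhdsWithin, nhdsWithin_le_nhds (isOpen_ne.mem_nhds hne.symm)]
    with z hzy hzx
  have hxz : nndist x z ≠ 0 := by simpa using hzx.symm
  exact hf hzx.symm hne hzy _ (pos_iff_ne_zero.2 (div_ne_zero hxz hpos))
    (div_mul_cancel₀ _ hpos).ge

/-- on `A_{n,m}`, at scales below `1/n`, an `η`-quasisymmetric map `f` is
biLipschitz: `d(x,y)/(η(1)·m) ≤ d(f x, f y) ≤ m·d(x,y)`. -/
theorem stmt9 (η : ℝ≥0 ≃ₜ ℝ≥0) (f : X → Y) (hf : IsQuasisymmetric η f)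
    (n m : ℕ) (hn : 0 < n) (hm : 0 < m) :
    ∀ x ∈ Anm f n m, ∀ y ∈ Anm f n m, dist x y < 1 / (n : ℝ) →
      dist x y / ((η 1 : ℝ) * (m : ℝ)) ≤ dist (f x) (f y) ∧
        dist (f x) (f y) ≤ (m : ℝ) * dist x y := by
  intro x hx y hy hxy
  refine ⟨?_, dist_le_of_mem_Anm hx hxy⟩
  rcases eq_or_ne x y with rfl | hne
  · simp
  have hself := hf.nndist_le_self hne (neBot_nhdsNE_of_mem_Anm hn hm hy)
    (continuousAt_of_mem_Anm hn hy)
  have hL : Lfr f x (dist x y) ≤ ((η 1 * nndist (f x) (f y) : ℝ≥0) : ℝ≥0∞) := by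
    refine iSup₂_le fun z hz ↦ ?_
    rw [edist_nndist, ENNReal.coe_le_coe]
    rcases eq_or_ne x z with rfl | hxz
    · simp
    rcases eq_or_ne z y with rfl | hzy
    · exact hself
    · refine hf hxz hne hzy 1 one_pos ?_
      rw [one_mul, ← NNReal.coe_le_coe]
      simpa [dist_comm] using hz
  have h := (hx _ (dist_pos.2 hne) hxy).1.trans hL
  rw [← ENNReal.ofReal_coe_nnreal, ENNReal.ofReal_le_ofReal_iff (by positivity)] at h
  push_cast at h
  rw [mul_comm, ← div_div]
  exact div_le_of_le_mul₀ (by positivity) dist_nonneg (by rwa [mul_comm])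
end
end

section
/- Let X be a separable metric space, Y a metric space, and f : X → Y an injective map satisfying the η-quasisymmetry condition. Let d ≥ 0 and let S ⊆ X be a set such that for every x ∈ S one has liminf_{r→0⁺} L_f(x,r)/r > 0 and limsup_{r→0⁺} L_f(x,r)/r < ∞. If H^d(f(S)) = 0, then H^d(S) = 0. -/
open Metric MeasureTheory Filter Topology ENNReal NNReal Set

noncomputable section

variable {X Y : Type*} [MetricSpace X] [MetricSpace Y]
  [MeasurableSpace X] [BorelSpace X] [MeasurableSpace Y] [BorelSpace Y]

/-- A quasisymmetric map distorts distances at `x` by at least a fixed multiple of `Lfr`. -/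
theorem IsQuasisymmetric.Lfr_dist_le {η : ℝ≥0 ≃ₜ ℝ≥0} {f : X → Y} (hf : IsQuasisymmetric η f)
    {x y : X} (hxy : x ≠ y) :
    Lfr f x (dist x y) ≤ (max 1 (η 1) : ℝ≥0) * edist (f x) (f y) := by
  refine iSup₂_le fun z hz => ?_
  rw [edist_nndist, edist_nndist, ← ENNReal.coe_mul, ENNReal.coe_le_coe]
  rcases eq_or_ne x z with rfl | hxz
  · simp
  rcases eq_or_ne z y with rfl | hzy
  · exact le_mul_of_one_le_left zero_le (le_max_left _ _)
  · have hle : nndist x z ≤ 1 * nndist x y := by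
      rw [one_mul, ← NNReal.coe_le_coe, coe_nndist, coe_nndist, dist_comm]
      exact hz
    exact (hf hxz hxy hzy 1 one_pos hle).trans (by gcongr; exact le_max_right _ _)

/-- If the lower limit of `L_f(x,r)/r` is positive, then a quasisymmetric map satisfies a pointwise
lower Lipschitz bound near `x`. -/
theorem IsQuasisymmetric.exists_nat_edist_le {η : ℝ≥0 ≃ₜ ℝ≥0} {f : X → Y}
    (hf : IsQuasisymmetric η f) {x : X}
    (hpos : 0 < liminf (fun r : ℝ => Lfr f x r / ENNReal.ofReal r) (𝓝[>] (0 : ℝ))) :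
    ∃ n : ℕ, ∀ y, dist x y < 1 / ((n : ℝ) + 1) →
      edist x y ≤ (n : ℝ≥0) * edist (f x) (f y) := by
  obtain ⟨c, hc0, hc⟩ := ENNReal.lt_iff_exists_nnreal_btwn.1 hpos
  have hc0' : c ≠ 0 := by
    rintro rfl
    simp at hc0
  obtain ⟨ε, hε, hεc⟩ := mem_nhdsGT_iff_exists_Ioo_subset.1 (eventually_lt_of_lt_liminf hc)
  obtain ⟨m, hm⟩ := exists_nat_ge (max 1 (η 1) / c)
  obtain ⟨k, hk⟩ := exists_nat_one_div_lt (Set.mem_Ioi.1 hε)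
  refine ⟨max m k, fun y hy => ?_⟩
  rcases eq_or_ne x y with rfl | hxy
  · simp
  have hyε : dist x y < ε := by
    refine hy.trans_le (le_trans ?_ hk.le)
    gcongr
    exact le_max_right _ _
  have hL : (c : ℝ≥0∞) < Lfr f x (dist x y) / ENNReal.ofReal (dist x y) :=
    hεc ⟨dist_pos.2 hxy, hyε⟩
  have hmul : (c : ℝ≥0∞) * edist x y ≤ (max 1 (η 1) : ℝ≥0) * edist (f x) (f y) := by
    rw [edist_dist x y]
    exact (ENNReal.mul_le_of_le_div hL.le).trans (hf.Lfr_dist_le hxy)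
  simp only [edist_nndist, ← ENNReal.coe_mul, ENNReal.coe_le_coe] at hmul ⊢
  calc nndist x y ≤ (max 1 (η 1) * nndist (f x) (f y)) / c := by
        rwa [le_div_iff₀' (pos_iff_ne_zero.2 hc0')]
    _ = max 1 (η 1) / c * nndist (f x) (f y) := by ring
    _ ≤ ((max m k : ℕ) : ℝ≥0) * nndist (f x) (f y) := by
        gcongr
        exact hm.trans (by exact_mod_cast le_max_left _ _)

/-- A set on which `f` satisfies a lower Lipschitz bound is `H^d`-null if its image is. -/
theorem hausdorffMeasure_eq_zero_of_edist_le {f : X → Y} {d : ℝ} (hd : 0 ≤ d) {K : ℝ≥0}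
    {T : Set X} (hT : ∀ x ∈ T, ∀ y ∈ T, edist x y ≤ K * edist (f x) (f y))
    (h0 : μH[d] (f '' T) = 0) : μH[d] T = 0 := by
  have hanti : AntilipschitzWith K (fun x : T => f x) := fun x y => hT x x.2 y y.2
  have h := hanti.le_hausdorffMeasure_image hd Set.univ
  have himage : (fun x : T => f x) '' Set.univ = f '' T := by
    rw [Set.image_univ, Set.image_eq_range]
  rw [himage, h0, mul_zero, nonpos_iff_eq_zero,
    ← isometry_subtype_coe.hausdorffMeasure_image (Or.inl hd), Set.image_univ,
    Subtype.range_coe] at h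
  exact h

/-- if `X` is separable, `f` is an injective `η`-quasisymmetric map, and at
every point of `S` the quantity `L_f(x,r)/r` has positive liminf and finite limsup as
`r → 0⁺`, then `H^d(f(S)) = 0` implies `H^d(S) = 0`. -/
theorem stmt10 [TopologicalSpace.SeparableSpace X]
    (η : ℝ≥0 ≃ₜ ℝ≥0) (f : X → Y) (hinj : Function.Injective f)
    (hf : IsQuasisymmetric η f) {d : ℝ} (hd : 0 ≤ d) (S : Set X)
    (hpos : ∀ x ∈ S,
      0 < liminf (fun r : ℝ => Lfr f x r / ENNReal.ofReal r) (𝓝[>] (0 : ℝ)))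
    (hfin : ∀ x ∈ S,
      limsup (fun r : ℝ => Lfr f x r / ENNReal.ofReal r) (𝓝[>] (0 : ℝ)) < ⊤)
    (hS : μH[d] (f '' S) = 0) :
    μH[d] S = 0 := by
  have : SecondCountableTopology X := UniformSpace.secondCountable_of_separable X
  let A : ℕ → Set X := fun n => {x ∈ S | ∀ y, dist x y < 1 / ((n : ℝ) + 1) →
    edist x y ≤ (n : ℝ≥0) * edist (f x) (f y)}
  have hSA : S ⊆ ⋃ n, A n := fun x hx => by
    obtain ⟨n, hn⟩ := hf.exists_nat_edist_le (hpos x hx)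
    exact Set.mem_iUnion.2 ⟨n, hx, hn⟩
  refine measure_mono_null hSA (measure_iUnion_null fun n => ?_)
  refine measure_null_of_locally_null _ fun x _ => ?_
  have hr : (0 : ℝ) < 1 / ((n : ℝ) + 1) / 2 := by positivity
  refine ⟨A n ∩ ball x (1 / ((n : ℝ) + 1) / 2),
    inter_mem_nhdsWithin _ (ball_mem_nhds x hr), ?_⟩
  refine hausdorffMeasure_eq_zero_of_edist_le (f := f) (K := n) hd (fun y hy z hz => ?_)
    (measure_mono_null (Set.image_mono fun y hy => hy.1.1) hS)
  refine hy.1.2 z ?_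
  linarith [dist_triangle_right y z x, mem_ball.1 hy.2, mem_ball.1 hz.2]
end
end

section
/- Let Q > 1, let X and Y be complete Ahlfors Q-regular metric spaces (with respect to their Q-dimensional Hausdorff measures), and let f : X → Y be a homeomorphism satisfying the η-quasisymmetry condition. Then for every α > 0, the family of all bounded Borel sets E ⊆ X for which H^{Q-1}(f(∂^α E)) = ∞ has Mod_{Q/(Q-1)} equal to zero, where in computing the modulus each such set E is assigned the measure H^{Q-1} restricted to ∂*E, and the base measure on X is H^Q. -/
open Metric MeasureTheory Filter Topology ENNReal NNReal Set

noncomputable section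

variable {X Y : Type*} [MetricSpace X] [MetricSpace Y]
  [MeasurableSpace X] [BorelSpace X] [MeasurableSpace Y] [BorelSpace Y]

/-- The measure-theoretic boundary `∂*E`, with densities taken w.r.t. `H^Q`. -/
def mBdry (Q : ℝ) (E : Set X) : Set X :=
  {x | 0 < limsup (fun r : ℝ => μH[Q] (Metric.ball x r ∩ E) / μH[Q] (Metric.ball x r))
        (𝓝[>] (0 : ℝ)) ∧
    0 < limsup (fun r : ℝ => μH[Q] (Metric.ball x r \ E) / μH[Q] (Metric.ball x r))
        (𝓝[>] (0 : ℝ))}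

/-- `∂^α E`: points of `∂* E` where the lower `(Q-1)`-codimensional density of
`H^{Q-1}⌞∂*E` exceeds `α`. -/
def alphaBdry (Q α : ℝ) (E : Set X) : Set X :=
  {x ∈ mBdry Q E | ENNReal.ofReal α <
    liminf (fun r : ℝ => μH[Q - 1] (mBdry Q E ∩ Metric.ball x r) / ENNReal.ofReal r ^ (Q - 1))
      (𝓝[>] (0 : ℝ))}

/-- The `Q/(Q-1)`-modulus of a family `𝓕` of subsets of `X`, where each `E ∈ 𝓕` is assigned
the measure `H^{Q-1}⌞∂*E` and the base measure is `H^Q`. -/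
def ModF (Q : ℝ) (𝓕 : Set (Set X)) : ℝ≥0∞ :=
  ⨅ ρ ∈ {ρ : X → ℝ≥0∞ | Measurable ρ ∧
      ∀ E ∈ 𝓕, 1 ≤ ∫⁻ x in mBdry Q E, ρ x ∂(μH[Q - 1] : Measure X)},
    ∫⁻ x, ρ x ^ (Q / (Q - 1)) ∂(μH[Q] : Measure X)


/-- A quantitative form of the strict convexity of `x ↦ x ^ p`. -/
lemma Real.exists_abs_sub_rpow_le {p : ℝ} (hp : 1 < p) {ε : ℝ} (hε : 0 < ε) :
    ∃ C : ℝ, 0 ≤ C ∧ ∀ a b : ℝ, 0 ≤ a → 0 ≤ b →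
      |a - b| ^ p + C * ((a + b) / 2) ^ p ≤ ε * (a ^ p + b ^ p) + C * ((a ^ p + b ^ p) / 2) := by
  have hp0 : 0 < p := by linarith
  set e : ℝ := min 1 (ε ^ p⁻¹) with he
  have he0 : 0 < e := lt_min one_pos (by positivity)
  have hep : e ^ p ≤ ε := by
    calc e ^ p ≤ (ε ^ p⁻¹) ^ p := Real.rpow_le_rpow he0.le (min_le_right _ _) hp0.le
      _ = ε := by rw [← Real.rpow_mul hε.le, inv_mul_cancel₀ hp0.ne', Real.rpow_one]
  have hconv := strictConvexOn_rpow hp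
  have hmid : ∀ a b : ℝ, 0 ≤ a → 0 ≤ b → ((a + b) / 2) ^ p ≤ (a ^ p + b ^ p) / 2 := by
    intro a b ha hb
    have := hconv.convexOn.2 (mem_Ici.2 ha) (mem_Ici.2 hb)
      (by norm_num : (0 : ℝ) ≤ 1 / 2) (by norm_num : (0 : ℝ) ≤ 1 / 2) (by norm_num)
    simp only [smul_eq_mul] at this
    calc ((a + b) / 2) ^ p = (1 / 2 * a + 1 / 2 * b) ^ p := by ring_nf
      _ ≤ _ := this
      _ = _ := by ring
  obtain ⟨s₀, hs₀, hmin⟩ := (isCompact_Icc (a := (0 : ℝ)) (b := 1 - e)).exists_isMinOn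
    (f := fun s : ℝ => (1 + s ^ p) / 2 - ((1 + s) / 2) ^ p)
    ⟨0, le_rfl, by linarith [min_le_left (1 : ℝ) (ε ^ p⁻¹)]⟩
    (by
      refine Continuous.continuousOn ?_
      have h1 : Continuous fun s : ℝ => s ^ p := Real.continuous_rpow_const hp0.le
      have h2 : Continuous fun s : ℝ => ((1 + s) / 2) ^ p :=
        h1.comp (by fun_prop : Continuous fun s : ℝ => (1 + s) / 2)
      fun_prop)
  set c : ℝ := (1 + s₀ ^ p) / 2 - ((1 + s₀) / 2) ^ p with hc
  have hc0 : 0 < c := by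
    have := hconv.2 (mem_Ici.2 zero_le_one) (mem_Ici.2 hs₀.1) (by linarith [hs₀.2])
      (by norm_num : (0 : ℝ) < 1 / 2) (by norm_num : (0 : ℝ) < 1 / 2) (by norm_num)
    simp only [smul_eq_mul, Real.one_rpow] at this
    have h2 : (1 + s₀) / 2 = 1 / 2 * 1 + 1 / 2 * s₀ := by ring
    rw [hc, h2]
    linarith
  have key : ∀ a b : ℝ, 0 ≤ b → b ≤ a →
      |a - b| ^ p + c⁻¹ * ((a + b) / 2) ^ p ≤
        ε * (a ^ p + b ^ p) + c⁻¹ * ((a ^ p + b ^ p) / 2) := by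
    intro a b hb hab
    have ha : 0 ≤ a := hb.trans hab
    have hbp : 0 ≤ b ^ p := Real.rpow_nonneg hb p
    have hap : 0 ≤ a ^ p := Real.rpow_nonneg ha p
    rw [abs_of_nonneg (sub_nonneg.2 hab)]
    by_cases h : a - b ≤ e * a
    · have h1 : (a - b) ^ p ≤ ε * a ^ p := by
        calc (a - b) ^ p ≤ (e * a) ^ p := Real.rpow_le_rpow (sub_nonneg.2 hab) h hp0.le
          _ = e ^ p * a ^ p := Real.mul_rpow he0.le ha
          _ ≤ ε * a ^ p := by gcongr
      have h2 : c⁻¹ * ((a + b) / 2) ^ p ≤ c⁻¹ * ((a ^ p + b ^ p) / 2) := by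
        gcongr
        exact hmid a b ha hb
      nlinarith
    · have ha0 : 0 < a := by
        rcases ha.eq_or_lt with h0 | h0
        · subst h0
          simp only [mul_zero, zero_sub] at h
          exact absurd (by linarith) h
        · exact h0
      obtain ⟨s, rfl⟩ : ∃ s, b = a * s := ⟨b / a, by field_simp⟩
      have hs0 : 0 ≤ s := nonneg_of_mul_nonneg_right hb ha0
      have hs1 : s ≤ 1 - e := by
        by_contra hcon
        apply h
        nlinarith
      have hgap : c ≤ (1 + s ^ p) / 2 - ((1 + s) / 2) ^ p := hmin (mem_Icc.2 ⟨hs0, hs1⟩)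
      have h1 : (a - a * s) ^ p ≤ a ^ p :=
        Real.rpow_le_rpow (sub_nonneg.2 hab) (by linarith) hp0.le
      have h2 : ((a + a * s) / 2) ^ p = a ^ p * ((1 + s) / 2) ^ p := by
        rw [← Real.mul_rpow ha (by positivity)]
        ring_nf
      have h4 : c⁻¹ * (c * a ^ p) = a ^ p := by field_simp
      have h5 : c⁻¹ * (c * a ^ p) ≤
          c⁻¹ * (a ^ p * ((1 + s ^ p) / 2 - ((1 + s) / 2) ^ p)) := by
        rw [mul_comm c]
        gcongr
      rw [h2, Real.mul_rpow ha hs0]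
      have h6 : 0 ≤ ε * (a ^ p + a ^ p * s ^ p) := by positivity
      have h7 : c⁻¹ * (a ^ p * ((1 + s ^ p) / 2 - ((1 + s) / 2) ^ p)) =
        c⁻¹ * ((a ^ p + a ^ p * s ^ p) / 2) - c⁻¹ * (a ^ p * ((1 + s) / 2) ^ p) := by ring
      linarith
  refine ⟨c⁻¹, by positivity, fun a b ha hb => ?_⟩
  rcases le_total b a with h | h
  · exact key a b hb h
  · have := key b a ha h
    rwa [abs_sub_comm, add_comm b a, add_comm (b ^ p)] at this

lemma ENNReal.exists_nndist_rpow_le {p : ℝ} (hp : 1 < p) {ε : ℝ≥0} (hε : 0 < ε) :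
    ∃ C : ℝ≥0, ∀ a b : ℝ≥0,
      (nndist a b : ℝ≥0∞) ^ p + C * (((a + b) / 2 : ℝ≥0) : ℝ≥0∞) ^ p ≤
        ε * ((a : ℝ≥0∞) ^ p + (b : ℝ≥0∞) ^ p) +
          C * (((a : ℝ≥0∞) ^ p + (b : ℝ≥0∞) ^ p) / 2) := by
  obtain ⟨C, hC, h⟩ := Real.exists_abs_sub_rpow_le hp (ε := ε) (by exact_mod_cast hε)
  lift C to ℝ≥0 using hC
  refine ⟨C, fun a b => ?_⟩
  have hp0 : 0 ≤ p := by linarith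
  simp only [← ENNReal.coe_rpow_of_nonneg _ hp0, ← ENNReal.coe_add, ← ENNReal.coe_mul]
  rw [← ENNReal.coe_ofNat, ← ENNReal.coe_div (by norm_num), ← ENNReal.coe_mul, ← ENNReal.coe_add,
    ENNReal.coe_le_coe, ← NNReal.coe_le_coe]
  have := h a b a.2 b.2
  push_cast
  rwa [NNReal.dist_eq]

/-- If `g k` is a sequence whose consecutive `L^p` distances decay fast, then the sequence is
dominated by a single `L^p` function. -/
lemma exists_lintegral_rpow_lt_top_forall_le {α : Type*} [MeasurableSpace α] {μ : Measure α}
    {p : ℝ} (hp : 1 < p) (g : ℕ → α → ℝ≥0) (hg : ∀ k, Measurable (g k))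
    (h0 : ∫⁻ x, (g 0 x : ℝ≥0∞) ^ p ∂μ < ⊤)
    (hd : ∀ k, ∫⁻ x, (nndist (g k x) (g (k + 1) x) : ℝ≥0∞) ^ p ∂μ ≤
      ((2 : ℝ≥0∞)⁻¹ ^ k) ^ p * (2 : ℝ≥0∞)⁻¹ ^ k) :
    ∃ ρ : α → ℝ≥0∞, Measurable ρ ∧ ∫⁻ x, ρ x ^ p ∂μ < ⊤ ∧ ∀ k x, (g k x : ℝ≥0∞) ≤ ρ x := by
  have hp0 : 0 < p := by linarith
  set H : α → ℝ≥0∞ := fun x => ⨆ k : ℕ, 2 ^ k * (nndist (g k x) (g (k + 1) x) : ℝ≥0∞) with hH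
  have hmd : ∀ k, Measurable fun x => (nndist (g k x) (g (k + 1) x) : ℝ≥0∞) := fun k =>
    ((hg k).nndist (hg (k + 1))).coe_nnreal_ennreal
  have hHm : Measurable H := Measurable.iSup fun k => (hmd k).const_mul _
  have hHp : ∫⁻ x, H x ^ p ∂μ ≤ 2 := by
    calc ∫⁻ x, H x ^ p ∂μ
        ≤ ∫⁻ x, ∑' k : ℕ, (2 ^ k * (nndist (g k x) (g (k + 1) x) : ℝ≥0∞)) ^ p ∂μ := by
          refine lintegral_mono fun x => ?_
          rw [← ENNReal.le_rpow_inv_iff hp0]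
          refine iSup_le fun k => ?_
          rw [ENNReal.le_rpow_inv_iff hp0]
          exact ENNReal.le_tsum (f := fun k : ℕ =>
            (2 ^ k * (nndist (g k x) (g (k + 1) x) : ℝ≥0∞)) ^ p) k
      _ = ∑' k : ℕ, ∫⁻ x, (2 ^ k * (nndist (g k x) (g (k + 1) x) : ℝ≥0∞)) ^ p ∂μ :=
          lintegral_tsum fun k => (((hmd k).const_mul _).pow_const p).aemeasurable
      _ ≤ ∑' k : ℕ, (2 : ℝ≥0∞)⁻¹ ^ k := by
          refine ENNReal.tsum_le_tsum fun k => ?_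
          simp_rw [ENNReal.mul_rpow_of_nonneg _ _ hp0.le]
          rw [lintegral_const_mul _ ((hmd k).pow_const p)]
          calc _ ≤ ((2 : ℝ≥0∞) ^ k) ^ p * (((2 : ℝ≥0∞)⁻¹ ^ k) ^ p * (2 : ℝ≥0∞)⁻¹ ^ k) := by
                gcongr
                exact hd k
            _ = _ := by
                rw [← mul_assoc, ← ENNReal.mul_rpow_of_nonneg _ _ hp0.le, ← mul_pow,
                  ENNReal.mul_inv_cancel (by norm_num) (by norm_num), one_pow, ENNReal.one_rpow,
                  one_mul]
      _ = 2 := by rw [ENNReal.tsum_geometric, ENNReal.one_sub_inv_two, inv_inv]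
  have hdk : ∀ k x, (nndist (g k x) (g (k + 1) x) : ℝ≥0∞) ≤ (2 : ℝ≥0∞)⁻¹ ^ k * H x := by
    intro k x
    calc (nndist (g k x) (g (k + 1) x) : ℝ≥0∞)
        = (2 : ℝ≥0∞)⁻¹ ^ k * (2 ^ k * (nndist (g k x) (g (k + 1) x) : ℝ≥0∞)) := by
          rw [← mul_assoc, ← mul_pow, ENNReal.inv_mul_cancel (by norm_num) (by norm_num), one_pow,
            one_mul]
      _ ≤ _ := by
          gcongr
          exact le_iSup (fun k : ℕ => 2 ^ k * (nndist (g k x) (g (k + 1) x) : ℝ≥0∞)) k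
  have hsum : ∀ k x, (g k x : ℝ≥0∞) ≤ g 0 x + (∑ j ∈ Finset.range k, (2 : ℝ≥0∞)⁻¹ ^ j) * H x := by
    intro k x
    induction k with
    | zero => simp
    | succ k ih =>
      rw [Finset.sum_range_succ, add_mul, ← add_assoc]
      refine le_trans ?_ (add_le_add ih (hdk k x))
      rw [← ENNReal.coe_add, ENNReal.coe_le_coe, ← NNReal.coe_le_coe]
      push_cast
      rw [NNReal.dist_eq]
      linarith [neg_abs_le ((g k x : ℝ) - g (k + 1) x)]
  refine ⟨(fun x => (g 0 x : ℝ≥0∞)) + fun x => 2 * H x,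
    (hg 0).coe_nnreal_ennreal.add (hHm.const_mul _), ?_, fun k x => ?_⟩
  · refine lintegral_rpow_add_lt_top_of_lintegral_rpow_lt_top
      (hg 0).coe_nnreal_ennreal.aemeasurable h0 ?_ hp.le
    simp_rw [ENNReal.mul_rpow_of_nonneg _ _ hp0.le]
    rw [lintegral_const_mul _ (hHm.pow_const p)]
    exact ENNReal.mul_lt_top (ENNReal.rpow_lt_top_of_nonneg hp0.le (by norm_num))
      (hHp.trans_lt (by norm_num))
  · refine (hsum k x).trans ?_
    simp only [Pi.add_apply]
    gcongr
    calc _ ≤ ∑' j : ℕ, (2 : ℝ≥0∞)⁻¹ ^ j := ENNReal.sum_le_tsum _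
      _ = 2 := by rw [ENNReal.tsum_geometric, ENNReal.one_sub_inv_two, inv_inv]

/-- A bounded sequence of nonnegative functions in `L^p` admits a single `L^p` function whose
integral against any measure dominates the lower limit of the integrals of the sequence. -/
lemma exists_lintegral_rpow_lt_top_forall_liminf_le {α : Type*} [MeasurableSpace α]
    {μ : Measure α} {p : ℝ} (hp : 1 < p) (g : ℕ → α → ℝ≥0) (hg : ∀ k, Measurable (g k))
    {M : ℝ≥0∞} (hM : M < ⊤) (hgM : ∀ k, ∫⁻ x, (g k x : ℝ≥0∞) ^ p ∂μ ≤ M) :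
    ∃ ρ : α → ℝ≥0∞, Measurable ρ ∧ ∫⁻ x, ρ x ^ p ∂μ < ⊤ ∧
      ∀ ν : Measure α, liminf (fun k => ∫⁻ x, (g k x : ℝ≥0∞) ∂ν) atTop ≤ ∫⁻ x, ρ x ∂ν := by
  have hp0 : 0 < p := by linarith
  set K : ℕ → Set (α → ℝ≥0) := fun n => {h | Measurable h ∧
    ∀ ν : Measure α, ⨅ j ≥ n, ∫⁻ x, (g j x : ℝ≥0∞) ∂ν ≤ ∫⁻ x, (h x : ℝ≥0∞) ∂ν} with hK
  set Φ : (α → ℝ≥0) → ℝ≥0∞ := fun h => ∫⁻ x, (h x : ℝ≥0∞) ^ p ∂μ with hΦ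
  have hKanti : ∀ {m n}, m ≤ n → K n ⊆ K m := fun {m n} hmn h hh =>
    ⟨hh.1, fun ν => le_trans (le_iInf₂ fun j hj => iInf₂_le j (hmn.trans hj)) (hh.2 ν)⟩
  have hgK : ∀ n, g n ∈ K n := fun n => ⟨hg n, fun ν => iInf₂_le n le_rfl⟩
  have hKmid : ∀ {n a b}, a ∈ K n → b ∈ K n → (fun x => (a x + b x) / 2) ∈ K n := by
    intro n a b ha hb
    refine ⟨(ha.1.add hb.1).div_const 2, fun ν => ?_⟩
    have h1 : ∀ x, (((a x + b x) / 2 : ℝ≥0) : ℝ≥0∞) = 2⁻¹ * ((a x : ℝ≥0∞) + b x) := fun x => by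
      rw [ENNReal.coe_div (by norm_num), ENNReal.coe_add, div_eq_mul_inv, mul_comm]
      norm_num
    simp_rw [h1]
    have hab : Measurable fun x => (a x : ℝ≥0∞) + b x :=
      ha.1.coe_nnreal_ennreal.add hb.1.coe_nnreal_ennreal
    rw [lintegral_const_mul _ hab,
      lintegral_add_left ha.1.coe_nnreal_ennreal]
    set I := ⨅ j ≥ n, ∫⁻ x, (g j x : ℝ≥0∞) ∂ν
    calc I = 2⁻¹ * (I + I) := by
          rw [← two_mul, ← mul_assoc, ENNReal.inv_mul_cancel (by norm_num) (by norm_num), one_mul]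
      _ ≤ _ := by
          gcongr
          exacts [ha.2 ν, hb.2 ν]
  set d : ℕ → ℝ≥0∞ := fun n => ⨅ h ∈ K n, Φ h with hd
  have hdM : ∀ n, d n ≤ M := fun n => (iInf₂_le (g n) (hgK n)).trans (hgM n)
  have hdmono : Monotone d := fun m n hmn => le_iInf₂ fun h hh => iInf₂_le h (hKanti hmn hh)
  set D : ℝ≥0∞ := ⨆ n, d n with hD
  have hDM : D ≤ M := iSup_le hdM
  have hDtop : D ≠ ⊤ := (hDM.trans_lt hM).ne
  have hdD : Tendsto d atTop (𝓝 D) := tendsto_atTop_iSup hdmono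
  set δ : ℕ → ℝ≥0∞ := fun n => (2 : ℝ≥0∞)⁻¹ ^ n with hδ
  have hδpos : ∀ n, 0 < δ n := fun n => ENNReal.pow_pos (by norm_num) n
  have hδ0 : Tendsto δ atTop (𝓝 0) :=
    ENNReal.tendsto_pow_atTop_nhds_zero_of_lt_one (by norm_num)
  have hδanti : Antitone δ := pow_right_anti₀ zero_le (by norm_num)
  have hδ1 : ∀ n, δ n ≤ 1 := fun n => pow_le_one₀ (by norm_num) (by norm_num)
  have hex : ∀ n, ∃ h ∈ K n, Φ h ≤ D + δ n := by
    intro n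
    have hlt : d n < D + δ n :=
      lt_of_le_of_lt (le_iSup d n) (ENNReal.lt_add_right hDtop (hδpos n).ne')
    simp only [hd, iInf_lt_iff] at hlt
    obtain ⟨h, hh, hlt⟩ := hlt
    exact ⟨h, hh, hlt.le⟩
  choose h hhK hhΦ using hex
  have hcauchy : ∀ τ : ℝ≥0∞, 0 < τ → ∀ᶠ n in atTop, ∀ m ≥ n,
      ∫⁻ x, (nndist (h n x) (h m x) : ℝ≥0∞) ^ p ∂μ ≤ τ := by
    intro τ hτ
    obtain ⟨ε, hε, hετ⟩ : ∃ ε : ℝ≥0, 0 < ε ∧ (ε : ℝ≥0∞) * (2 * (M + 1)) < τ := by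
      have ht : Tendsto (fun e : ℝ≥0 => (e : ℝ≥0∞) * (2 * (M + 1))) (𝓝[>] 0) (𝓝 0) := by
        have : Tendsto (fun e : ℝ≥0 => (e : ℝ≥0∞) * (2 * (M + 1))) (𝓝 0)
            (𝓝 (((0 : ℝ≥0) : ℝ≥0∞) * (2 * (M + 1)))) :=
          ENNReal.Tendsto.mul_const (ENNReal.tendsto_coe.2 tendsto_id)
            (Or.inr (ENNReal.mul_ne_top (by norm_num) (ENNReal.add_ne_top.2 ⟨hM.ne, by norm_num⟩)))
        simp only [ENNReal.coe_zero, zero_mul] at this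
        exact this.mono_left nhdsWithin_le_nhds
      obtain ⟨e, he1, he2⟩ := ((ht.eventually_lt_const hτ).and self_mem_nhdsWithin).exists
      exact ⟨e, he2, he1⟩
    obtain ⟨C, hC⟩ := ENNReal.exists_nndist_rpow_le hp hε
    have hlim : Tendsto (fun n => (ε : ℝ≥0∞) * (2 * (M + 1)) + (C * (D + δ n) - C * d n)) atTop
        (𝓝 ((ε : ℝ≥0∞) * (2 * (M + 1)) + (C * (D + 0) - C * D))) := by
      refine tendsto_const_nhds.add (ENNReal.Tendsto.sub ?_ ?_ (Or.inl ?_))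
      · exact ENNReal.Tendsto.const_mul (tendsto_const_nhds.add hδ0) (Or.inr ENNReal.coe_ne_top)
      · exact ENNReal.Tendsto.const_mul hdD (Or.inr ENNReal.coe_ne_top)
      · exact ENNReal.mul_ne_top ENNReal.coe_ne_top (by simpa using hDtop)
    rw [add_zero, tsub_self, add_zero] at hlim
    filter_upwards [hlim.eventually_lt_const hετ] with n hn m hm
    refine le_trans ?_ hn.le
    have hKm : h m ∈ K n := hKanti hm (hhK m)
    have hΦm : Φ (h m) ≤ D + δ n := (hhΦ m).trans (by gcongr; exact hδanti hm)
    have hD1 : D + δ n ≤ M + 1 := add_le_add hDM (hδ1 n)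
    have hlint : ∫⁻ x, (nndist (h n x) (h m x) : ℝ≥0∞) ^ p ∂μ +
        C * Φ (fun x => (h n x + h m x) / 2) ≤
        ε * (Φ (h n) + Φ (h m)) + C * ((Φ (h n) + Φ (h m)) / 2) := by
      have hmn := (hhK n).1.coe_nnreal_ennreal.pow_const p
      have hmm := (hhK m).1.coe_nnreal_ennreal.pow_const p
      have h1 := ((hhK n).1.nndist (hhK m).1).coe_nnreal_ennreal.pow_const p
      have h2 := (hKmid (hhK n) hKm).1.coe_nnreal_ennreal.pow_const p
      calc _ = ∫⁻ x, ((nndist (h n x) (h m x) : ℝ≥0∞) ^ p +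
            C * (((h n x + h m x) / 2 : ℝ≥0) : ℝ≥0∞) ^ p) ∂μ := by
            rw [lintegral_add_left h1, lintegral_const_mul _ h2]
        _ ≤ ∫⁻ x, (ε * ((h n x : ℝ≥0∞) ^ p + (h m x : ℝ≥0∞) ^ p) +
            C * (((h n x : ℝ≥0∞) ^ p + (h m x : ℝ≥0∞) ^ p) / 2)) ∂μ :=
            lintegral_mono fun x => hC _ _
        _ = _ := by
            have hs : Measurable fun x => (h n x : ℝ≥0∞) ^ p + (h m x : ℝ≥0∞) ^ p := hmn.add hmm
            simp_rw [div_eq_mul_inv]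
            rw [lintegral_add_left (hs.const_mul _), lintegral_const_mul _ hs,
              lintegral_const_mul _ (hs.mul_const _), lintegral_mul_const _ hs,
              lintegral_add_left hmn]
    have hfin : (C : ℝ≥0∞) * d n ≠ ⊤ :=
      ENNReal.mul_ne_top ENNReal.coe_ne_top ((hdM n).trans_lt hM).ne
    have hle : (C : ℝ≥0∞) * d n ≤ C * (D + δ n) := by
      gcongr
      exact (le_iSup d n).trans le_self_add
    rw [← ENNReal.add_sub_cancel_right (a := ∫⁻ x, (nndist (h n x) (h m x) : ℝ≥0∞) ^ p ∂μ) hfin,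
      ← (ENNReal.cancel_of_ne hfin).add_tsub_assoc_of_le hle]
    refine tsub_le_tsub_right ?_ _
    calc _ ≤ ∫⁻ x, (nndist (h n x) (h m x) : ℝ≥0∞) ^ p ∂μ +
          C * Φ (fun x => (h n x + h m x) / 2) := by
          gcongr
          exact iInf₂_le _ (hKmid (hhK n) hKm)
      _ ≤ _ := hlint
      _ ≤ ε * ((M + 1) + (M + 1)) + C * (((D + δ n) + (D + δ n)) / 2) := by
          gcongr
          exacts [(hhΦ n).trans hD1, hΦm.trans hD1, hhΦ n]
      _ = _ := by
          rw [← two_mul, ← two_mul, mul_div_assoc, ENNReal.mul_div_cancel (by norm_num) (by norm_num)]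
  obtain ⟨φ, hφ, hφd⟩ := extraction_forall_of_eventually (P := fun k n => ∀ m ≥ n,
      ∫⁻ x, (nndist (h n x) (h m x) : ℝ≥0∞) ^ p ∂μ ≤ (δ k) ^ p * δ k)
    fun k => hcauchy _ (ENNReal.mul_pos
      (ENNReal.rpow_pos (hδpos k) ((hδ1 k).trans_lt (by norm_num)).ne).ne' (hδpos k).ne')
  obtain ⟨ρ, hρm, hρp, hρ⟩ := exists_lintegral_rpow_lt_top_forall_le (μ := μ) hp
    (fun k => h (φ k)) (fun k => (hhK _).1)
    ((hhΦ (φ 0)).trans_lt (ENNReal.add_lt_top.2 ⟨hDtop.lt_top, (hδ1 _).trans_lt (by norm_num)⟩))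
    (fun k => hφd k _ (hφ.monotone k.le_succ))
  refine ⟨ρ, hρm, hρp, fun ν => ?_⟩
  rw [liminf_eq_iSup_iInf_of_nat]
  refine iSup_le fun n => ?_
  exact ((hKanti hφ.le_apply (hhK (φ n))).2 ν).trans (lintegral_mono fun x => hρ n x)

namespace AhlforsRegular

variable {μ : Measure X} {Q : ℝ} {C : ℝ≥0}

omit [BorelSpace X] in
lemma measure_ball_le [Nontrivial X] (h : AhlforsRegular X μ Q C) (hQ : 0 ≤ Q) (x : X) {r : ℝ}
    (hr : 0 < r) : μ (ball x r) ≤ C * ENNReal.ofReal r ^ Q := by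
  by_cases hlt : ENNReal.ofReal r < 2 * Metric.ediam (Set.univ : Set X)
  · exact (h.2 x r hr hlt).2
  · rw [not_lt] at hlt
    set d := Metric.ediam (Set.univ : Set X) with hd
    obtain ⟨a, b, hab⟩ := exists_pair_ne X
    have hd0 : d ≠ 0 := fun h0 => hab <| edist_eq_zero.1 <| nonpos_iff_eq_zero.1 <|
      h0 ▸ Metric.edist_le_ediam_of_mem (mem_univ a) (mem_univ b)
    have hdtop : d ≠ ⊤ := by
      rintro h1
      rw [h1, ENNReal.mul_top (by norm_num), top_le_iff] at hlt
      exact ENNReal.ofReal_ne_top hlt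
    have hd' : 0 < d.toReal := ENNReal.toReal_pos hd0 hdtop
    set s : ℝ := 3 / 2 * d.toReal with hs
    have hsd : s < 2 * d.toReal := by rw [hs]; linarith
    have h2d : ENNReal.ofReal (2 * d.toReal) = 2 * d := by
      rw [ENNReal.ofReal_mul (by norm_num), ENNReal.ofReal_toReal hdtop]
      norm_num
    have hsr : s ≤ r := by
      rw [← h2d, ENNReal.ofReal_le_ofReal_iff hr.le] at hlt
      linarith
    have hball : ball x s = Set.univ := by
      refine eq_univ_of_forall fun y => ?_
      have h1 : dist y x ≤ d.toReal := by
        rw [dist_edist]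
        exact ENNReal.toReal_mono hdtop
          (Metric.edist_le_ediam_of_mem (mem_univ y) (mem_univ x))
      exact mem_ball.2 (h1.trans_lt (by rw [hs]; linarith))
    calc μ (ball x r) ≤ μ (ball x s) := measure_mono (by simp [hball])
      _ ≤ C * ENNReal.ofReal s ^ Q := by
          refine (h.2 x s (by positivity) ?_).2
          exact ((ENNReal.ofReal_lt_ofReal_iff (by positivity)).2 hsd).trans_eq h2d
      _ ≤ _ := by gcongr

omit [BorelSpace X] in
lemma measure_ball_lt_top [Nontrivial X] (h : AhlforsRegular X μ Q C) (hQ : 0 ≤ Q) (x : X)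
    {r : ℝ} (hr : 0 < r) : μ (ball x r) < ⊤ :=
  (h.measure_ball_le hQ x hr).trans_lt
    (ENNReal.mul_lt_top ENNReal.coe_lt_top
      (ENNReal.rpow_lt_top_of_nonneg hQ ENNReal.ofReal_ne_top))

omit [BorelSpace X] in
lemma measure_ball_pos [Nontrivial X] (h : AhlforsRegular X μ Q C) (x : X) {r : ℝ}
    (hr : 0 < r) : 0 < μ (ball x r) := by
  obtain ⟨a, b, hab⟩ := exists_pair_ne X
  set s := min r (dist a b) with hs
  have hs0 : 0 < s := lt_min hr (dist_pos.2 hab)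
  have hlt : ENNReal.ofReal s < 2 * Metric.ediam (Set.univ : Set X) := by
    have h0 : edist a b ≠ 0 := fun h0 => hab (edist_eq_zero.1 h0)
    calc ENNReal.ofReal s ≤ edist a b := by
          rw [edist_dist]
          exact ENNReal.ofReal_le_ofReal (min_le_right _ _)
      _ < 2 * edist a b := by
          rw [two_mul]
          exact ENNReal.lt_add_right (edist_ne_top a b) h0
      _ ≤ _ := by
          gcongr
          exact Metric.edist_le_ediam_of_mem (mem_univ a) (mem_univ b)
  refine lt_of_lt_of_le ?_ ((h.2 x s hs0 hlt).1.trans (measure_mono (ball_subset_ball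
    (min_le_left _ _))))
  exact ENNReal.div_pos
    (ENNReal.rpow_pos (ENNReal.ofReal_pos.2 hs0) ENNReal.ofReal_ne_top).ne' ENNReal.coe_ne_top

omit [BorelSpace X] in
lemma sigmaFinite [Nontrivial X] (h : AhlforsRegular X μ Q C) (hQ : 0 ≤ Q) : SigmaFinite μ := by
  obtain ⟨x, -⟩ := exists_pair_ne X
  refine ⟨⟨⟨fun n : ℕ => ball x (n + 1), fun _ => trivial,
    fun n => h.measure_ball_lt_top hQ x (by positivity), ?_⟩⟩⟩
  refine iUnion_eq_univ_iff.2 fun y => ?_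
  obtain ⟨n, hn⟩ := exists_nat_gt (dist y x)
  exact ⟨n, mem_ball.2 (by linarith)⟩

lemma secondCountableTopology [Nontrivial X] (h : AhlforsRegular X μ Q C) (hQ : 0 ≤ Q) :
    SecondCountableTopology X := by
  have := h.sigmaFinite hQ
  refine Metric.secondCountable_of_almost_dense_set fun ε hε => ?_
  obtain ⟨u, -, hdisj, hcov⟩ := Vitali.exists_disjoint_subfamily_covering_enlargement_closedBall
    (Set.univ : Set X) id (fun _ => ε / 5) (ε / 5) (fun _ _ => le_rfl) 5 (by norm_num)
  refine ⟨u, ?_, fun x => ?_⟩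
  · have hc := Measure.countable_meas_pos_of_disjoint_iUnion (μ := μ)
      (As := fun a : u => closedBall (a : X) (ε / 5)) (fun _ => measurableSet_closedBall)
      (fun a b hab => hdisj a.2 b.2 (Subtype.coe_injective.ne hab))
    have huniv : {a : u | 0 < μ (closedBall (a : X) (ε / 5))} = Set.univ :=
      eq_univ_of_forall fun a => (h.measure_ball_pos (a : X) (by positivity)).trans_le
        (measure_mono ball_subset_closedBall)
    rw [huniv] at hc
    exact Set.countable_coe_iff.1 (Set.countable_univ_iff.1 hc)
  · obtain ⟨b, hb, hsub⟩ := hcov x (mem_univ x)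
    refine ⟨b, hb, ?_⟩
    have := hsub (mem_closedBall_self (by positivity))
    simpa [mul_div_cancel₀] using this

end AhlforsRegular

lemma Homeomorph.nnreal_apply_zero (η : ℝ≥0 ≃ₜ ℝ≥0) : η 0 = 0 := by
  rcases η.continuous.strictMono_of_inj η.injective with h | h
  · obtain ⟨t, ht⟩ := η.surjective 0
    exact nonpos_iff_eq_zero.1 ((h.monotone zero_le).trans_eq ht)
  · obtain ⟨t, ht⟩ := η.surjective (η 0 + 1)
    have h1 : η t ≤ η 0 := h.antitone zero_le
    rw [ht] at h1
    exact absurd h1 (not_le.2 (lt_add_one _))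

namespace IsQuasisymmetric

variable {η : ℝ≥0 ≃ₜ ℝ≥0}

omit [MeasurableSpace X] [BorelSpace X] [MeasurableSpace Y] [BorelSpace Y] in
lemma isBounded_image_ball [Nontrivial X] {f : X → Y} (hf : IsQuasisymmetric η f) (x : X)
    (r : ℝ) : Bornology.IsBounded (f '' ball x r) := by
  obtain ⟨a, ha⟩ := exists_ne x
  rcases le_or_gt r 0 with hr | hr
  · simp [ball_eq_empty.2 hr]
  have hd : 0 < nndist x a := pos_iff_ne_zero.2 (mt nndist_eq_zero.1 ha.symm)
  set t : ℝ≥0 := r.toNNReal / nndist x a with ht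
  have ht0 : 0 < t := div_pos (Real.toNNReal_pos.2 hr) hd
  refine (isBounded_closedBall (x := f x)
    (r := (max (η t * nndist (f x) (f a)) (nndist (f x) (f a)) : ℝ≥0))).subset ?_
  rintro _ ⟨y, hy, rfl⟩
  rw [mem_closedBall, dist_comm, ← coe_nndist, NNReal.coe_le_coe]
  by_cases hyx : y = x
  · simp [hyx]
  by_cases hya : y = a
  · simp [hya]
  refine (hf (Ne.symm hyx) ha.symm hya t ht0 ?_).trans (le_max_left _ _)
  rw [ht, div_mul_cancel₀ _ hd.ne', ← NNReal.coe_le_coe, coe_nndist, Real.coe_toNNReal _ hr.le,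
    dist_comm]
  exact (mem_ball.1 hy).le

omit [MeasurableSpace X] [BorelSpace X] [MeasurableSpace Y] [BorelSpace Y] in
lemma exists_forall_dist_le [Nontrivial X] {f : X → Y} (hf : IsQuasisymmetric η f) (x₀ : X)
    (R : ℝ) {δ : ℝ} (hδ : 0 < δ) :
    ∃ r₀ > 0, ∀ x ∈ ball x₀ R, ∀ y, dist y x < r₀ → dist (f y) (f x) ≤ δ := by
  obtain ⟨a, b, hab⟩ := exists_pair_ne X
  have hd : 0 < dist a b := dist_pos.2 hab
  obtain ⟨M, hM⟩ := Metric.isBounded_iff.1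
    (hf.isBounded_image_ball x₀ (max R (max (dist a x₀ + 1) (dist b x₀ + 1))))
  have hev : ∀ᶠ t : ℝ≥0 in 𝓝 0, (η t : ℝ) * max M 0 < δ := by
    have hc : Continuous fun t : ℝ≥0 => (η t : ℝ) * max M 0 :=
      (NNReal.continuous_coe.comp η.continuous).mul continuous_const
    have h0 := hc.tendsto 0
    rw [η.nnreal_apply_zero, NNReal.coe_zero, zero_mul] at h0
    exact h0.eventually_lt_const hδ
  obtain ⟨t, ht, ht0⟩ :=
    ((hev.filter_mono nhdsWithin_le_nhds).and (self_mem_nhdsWithin (s := Ioi 0))).exists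
  replace ht0 : (0 : ℝ≥0) < t := ht0
  refine ⟨min (dist a b / 2) (t * (dist a b / 2)), lt_min (by positivity) (by positivity),
    fun x hx y hy => ?_⟩
  by_cases hyx : y = x
  · simp [hyx, hδ.le]
  have hz : ∀ z ∈ ball x₀ (max R (max (dist a x₀ + 1) (dist b x₀ + 1))),
      dist a b / 2 ≤ dist x z → dist (f y) (f x) ≤ δ := by
    intro z hz hxz
    have hxz' : x ≠ z := fun h => by
      rw [h, dist_self] at hxz
      linarith
    have hyz : y ≠ z := fun h => by
      rw [h, dist_comm] at hy
      exact absurd (hy.trans_le (min_le_left _ _)) (not_lt.2 hxz)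
    have h1 := hf (Ne.symm hyx) hxz' hyz t ht0 (by
      rw [← NNReal.coe_le_coe, NNReal.coe_mul, coe_nndist, coe_nndist, dist_comm x y]
      calc dist y x ≤ t * (dist a b / 2) := (hy.trans_le (min_le_right _ _)).le
        _ ≤ t * dist x z := by gcongr)
    rw [← NNReal.coe_le_coe, NNReal.coe_mul, coe_nndist, coe_nndist] at h1
    rw [dist_comm]
    refine h1.trans (le_trans ?_ ht.le)
    gcongr
    exact (hM (mem_image_of_mem f (ball_subset_ball (le_max_left _ _) hx))
      (mem_image_of_mem f hz)).trans (le_max_left _ _)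
  by_cases hxa : dist a b / 2 ≤ dist x a
  · refine hz a (mem_ball.2 ?_) hxa
    exact lt_max_of_lt_right (lt_max_of_lt_left (lt_add_one _))
  · refine hz b (mem_ball.2 ?_) ?_
    · exact lt_max_of_lt_right (lt_max_of_lt_right (lt_add_one _))
    · linarith [dist_triangle a x b, dist_comm a x]

omit [MeasurableSpace X] [BorelSpace X] [BorelSpace Y] in
lemma exists_edist_rpow_le {f : X ≃ₜ Y} (hf : IsQuasisymmetric η f) {μ : Measure Y} {Q : ℝ}
    (hQ : 0 < Q) {C : ℝ≥0} (hY : AhlforsRegular Y μ Q C) :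
    ∃ K : ℝ≥0, ∀ (x : X) (r : ℝ), ∀ y ∈ ball x r,
      edist (f x) (f y) ^ Q ≤ K * μ (f '' ball x r) := by
  set c : ℝ≥0 := max 1 (η 1) with hc
  have hc0 : 0 < c := lt_max_of_lt_left one_pos
  have hC0 : C ≠ 0 := (zero_lt_one.trans_le hY.1).ne'
  refine ⟨c ^ Q * C, fun x r y hy => ?_⟩
  by_cases hyx : y = x
  · simp [hyx, hQ]
  set s : ℝ≥0 := nndist (f x) (f y) / c with hs
  have hxy : 0 < nndist (f x) (f y) :=
    pos_iff_ne_zero.2 (mt nndist_eq_zero.1 (f.injective.ne (Ne.symm hyx)))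
  have hs0 : 0 < s := div_pos hxy hc0
  have hsub : ball (f x) s ⊆ f '' ball x r := by
    intro w hw
    obtain ⟨z, rfl⟩ := f.surjective w
    refine mem_image_of_mem f ?_
    by_contra hz
    rw [mem_ball, not_lt] at hz
    have hr : 0 < r := pos_of_mem_ball hy
    have hzx : z ≠ x := fun h => by
      rw [h, dist_self] at hz
      linarith
    have hyz : y ≠ z := fun h => by
      rw [mem_ball, h] at hy
      linarith
    have h1 := hf (Ne.symm hyx) hzx.symm hyz 1 one_pos (by
      rw [one_mul, ← NNReal.coe_le_coe, coe_nndist, coe_nndist, dist_comm x y, dist_comm x z]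
      exact (mem_ball.1 hy).le.trans hz)
    have h2 : nndist (f x) (f y) ≤ nndist (f x) (f z) * c := by
      rw [mul_comm]
      exact h1.trans (by gcongr; exact le_max_right _ _)
    have h3 : s ≤ nndist (f x) (f z) := div_le_of_le_mul₀ hc0.le zero_le h2
    rw [mem_ball, dist_comm, ← coe_nndist, NNReal.coe_lt_coe] at hw
    exact absurd hw (not_lt.2 h3)
  have hlt : ENNReal.ofReal s < 2 * Metric.ediam (Set.univ : Set Y) := by
    have h0 : edist (f x) (f y) ≠ 0 := by
      rw [edist_nndist]
      exact_mod_cast hxy.ne'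
    calc ENNReal.ofReal s = (s : ℝ≥0∞) := ENNReal.ofReal_coe_nnreal
      _ ≤ edist (f x) (f y) := by
          rw [edist_nndist, ENNReal.coe_le_coe]
          exact div_le_of_le_mul₀ hc0.le zero_le (le_mul_of_one_le_right zero_le (le_max_left _ _))
      _ < 2 * edist (f x) (f y) := by
          rw [two_mul]
          exact ENNReal.lt_add_right (edist_ne_top _ _) h0
      _ ≤ _ := by
          gcongr
          exact Metric.edist_le_ediam_of_mem (mem_univ _) (mem_univ _)
  have hμ := (hY.2 (f x) s (by exact_mod_cast hs0) hlt).1.trans (measure_mono hsub)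
  rw [ENNReal.ofReal_coe_nnreal, ENNReal.div_le_iff (by exact_mod_cast hC0) ENNReal.coe_ne_top]
    at hμ
  have hcs : edist (f x) (f y) = c * s := by
    rw [edist_nndist, ← ENNReal.coe_mul, hs, mul_div_cancel₀ _ hc0.ne']
  rw [hcs, ENNReal.mul_rpow_of_nonneg _ _ hQ.le, ENNReal.coe_mul,
    ENNReal.coe_rpow_of_nonneg _ hQ.le, mul_assoc]
  gcongr
  rwa [mul_comm]

omit [MeasurableSpace X] [BorelSpace X] [BorelSpace Y] in
lemma exists_ediam_image_ball_rpow_le {f : X ≃ₜ Y} (hf : IsQuasisymmetric η f) {μ : Measure Y}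
    {Q : ℝ} (hQ : 1 < Q) {C : ℝ≥0} (hY : AhlforsRegular Y μ Q C) :
    ∃ K : ℝ≥0∞, K ≠ ⊤ ∧ ∀ (x : X) (r : ℝ),
      Metric.ediam (f '' ball x r) ^ (Q - 1) ≤ K * μ (f '' ball x r) ^ ((Q - 1) / Q) := by
  have hQ0 : 0 < Q := by linarith
  have hQ1 : 0 ≤ Q - 1 := by linarith
  obtain ⟨K, hK⟩ := hf.exists_edist_rpow_le hQ0 hY
  refine ⟨2 ^ (Q - 1) * (K : ℝ≥0∞) ^ ((Q - 1) / Q), ENNReal.mul_ne_top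
    (ENNReal.rpow_ne_top_of_nonneg hQ1 (by norm_num))
    (ENNReal.rpow_ne_top_of_nonneg (by positivity) ENNReal.coe_ne_top), fun x r => ?_⟩
  set L : ℝ≥0∞ := (K * μ (f '' ball x r)) ^ Q⁻¹ with hL
  have hdiam : Metric.ediam (f '' ball x r) ≤ 2 * L := by
    rw [Metric.ediam_image_le_iff]
    intro y hy z hz
    have h1 : ∀ y ∈ ball x r, edist (f x) (f y) ≤ L := fun y hy =>
      (ENNReal.le_rpow_inv_iff hQ0).2 (hK x r y hy)
    rw [two_mul]
    exact (edist_triangle_left _ _ (f x)).trans (add_le_add (h1 y hy) (h1 z hz))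
  calc _ ≤ (2 * L) ^ (Q - 1) := ENNReal.rpow_le_rpow hdiam hQ1
    _ = _ := by
      rw [ENNReal.mul_rpow_of_nonneg _ _ hQ1, hL, ← ENNReal.rpow_mul,
        show Q⁻¹ * (Q - 1) = (Q - 1) / Q by field_simp,
        ENNReal.mul_rpow_of_nonneg _ _ (by positivity), mul_assoc]

end IsQuasisymmetric

lemma lintegral_measure_ball [SecondCountableTopology X] (μ ν : Measure X) [SFinite μ]
    [SFinite ν] (r : ℝ) : ∫⁻ x, ν (ball x r) ∂μ = ∫⁻ y, μ (ball y r) ∂ν := by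
  have hs : MeasurableSet {z : X × X | dist z.1 z.2 < r} :=
    measurableSet_lt (measurable_fst.dist measurable_snd) measurable_const
  calc _ = (μ.prod ν) {z : X × X | dist z.1 z.2 < r} := by
        rw [Measure.prod_apply hs]
        refine lintegral_congr fun x => congrArg ν ?_
        ext y
        simp [dist_comm]
    _ = _ := by
        rw [Measure.prod_apply_symm hs]
        refine lintegral_congr fun x => congrArg μ ?_
        ext y
        simp

lemma measurable_measure_ball [SecondCountableTopology X] (ν : Measure X) [SFinite ν] (r : ℝ) :
    Measurable fun x => ν (ball x r) := by
  have hs : MeasurableSet {z : X × X | dist z.2 z.1 < r} :=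
    measurableSet_lt (measurable_snd.dist measurable_fst) measurable_const
  exact measurable_measure_prodMk_left hs

/-- If every ball of radius `ε` centred on `A` has `σ`-measure at least `m`, then `A` is covered
by countably many enlarged balls whose total weight is controlled by an integral. -/
lemma exists_countable_cover_mul_tsum_le [SecondCountableTopology X] {σ : Measure X} {A : Set X}
    {ε : ℝ} (hε : 0 < ε) {m : ℝ≥0∞} (hA : ∀ x ∈ A, m ≤ σ (ball x ε)) {g V : X → ℝ≥0∞}
    (hV : ∀ x ∈ A, ∀ y ∈ ball x ε, V x ≤ g y) :
    ∃ u ⊆ A, u.Countable ∧ A ⊆ ⋃ x : u, ball (x : X) (6 * ε) ∧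
      m * ∑' x : u, V x ≤ ∫⁻ y, g y ∂σ := by
  obtain ⟨u, huA, hdisj, hcov⟩ := Vitali.exists_disjoint_subfamily_covering_enlargement_closedBall
    A id (fun _ => ε) ε (fun _ _ => le_rfl) 5 (by norm_num)
  have hc : u.Countable := hdisj.countable_of_nonempty_interior fun x _ =>
    ⟨x, ball_subset_interior_closedBall (mem_ball_self hε)⟩
  refine ⟨u, huA, hc, fun x hx => ?_, ?_⟩
  · obtain ⟨b, hb, hsub⟩ := hcov x hx
    have h1 : x ∈ closedBall b (5 * ε) := hsub (mem_closedBall_self hε.le)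
    exact mem_iUnion.2 ⟨⟨b, hb⟩, closedBall_subset_ball (by linarith) h1⟩
  · have := hc.to_subtype
    rw [← ENNReal.tsum_mul_left]
    calc ∑' x : u, m * V x ≤ ∑' x : u, ∫⁻ y in ball (x : X) ε, g y ∂σ := by
          refine ENNReal.tsum_le_tsum fun x => ?_
          calc m * V x ≤ V x * σ (ball (x : X) ε) := by
                rw [mul_comm]
                gcongr
                exact hA x (huA x.2)
            _ = ∫⁻ y in ball (x : X) ε, V x ∂σ := (setLIntegral_const _ _).symm
            _ ≤ _ := setLIntegral_mono' measurableSet_ball fun y hy => hV x (huA x.2) y hy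
      _ = ∫⁻ y in ⋃ x : u, ball (x : X) ε, g y ∂σ := by
          rw [lintegral_iUnion (fun _ => measurableSet_ball)]
          exact fun a b hab => (hdisj a.2 b.2 (Subtype.coe_injective.ne hab)).mono
            ball_subset_closedBall ball_subset_closedBall
      _ ≤ _ := setLIntegral_le_lintegral _ _

lemma mBdry_subset_closure (Q : ℝ) (E : Set X) :
    mBdry Q E ⊆ closure E := by
  intro x hx
  by_contra hcl
  obtain ⟨ε, hε, hball⟩ := Metric.isOpen_iff.1 isClosed_closure.isOpen_compl x hcl
  have hev : (fun r : ℝ => μH[Q] (ball x r ∩ E) / μH[Q] (ball x r)) =ᶠ[𝓝[>] (0 : ℝ)]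
      fun _ => 0 := by
    filter_upwards [Ioo_mem_nhdsGT hε] with r hr
    have h0 : ball x r ∩ E = ∅ := by
      refine eq_empty_of_forall_notMem fun y hy => ?_
      exact hball (ball_subset_ball hr.2.le hy.1) (subset_closure hy.2)
    simp [h0]
  have h1 := hx.1
  rw [limsup_congr hev] at h1
  simp at h1

/-- The points of `∂^α E` at which the lower density bound holds at all scales below `1 / (n + 1)`
exhaust `∂^α E`. -/
lemma alphaBdry_subset_iUnion (Q α : ℝ) (E : Set X) :
    alphaBdry Q α E ⊆ ⋃ n : ℕ, {x ∈ mBdry Q E | ∀ r : ℝ, 0 < r → r < 1 / ((n : ℝ) + 1) →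
      ENNReal.ofReal α * ENNReal.ofReal r ^ (Q - 1) ≤ μH[Q - 1] (mBdry Q E ∩ ball x r)} := by
  rintro x ⟨hx, hlim⟩
  have hev := eventually_lt_of_lt_liminf hlim
  obtain ⟨u, hu, hsub⟩ := mem_nhdsGT_iff_exists_Ioo_subset.1 hev
  obtain ⟨n, hn⟩ := exists_nat_one_div_lt (show (0 : ℝ) < u from hu)
  refine mem_iUnion.2 ⟨n, hx, fun r hr hrn => ?_⟩
  have h1 : ENNReal.ofReal α <
    μH[Q - 1] (mBdry Q E ∩ ball x r) / ENNReal.ofReal r ^ (Q - 1) := hsub ⟨hr, hrn.trans hn⟩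
  exact ENNReal.mul_le_of_le_div h1.le

lemma ModF_iUnion_eq_zero {Q : ℝ} (hQ : 1 < Q) (𝓕 : ℕ → Set (Set X))
    (h𝓕 : ∀ n, ∃ ρ : X → ℝ≥0∞, Measurable ρ ∧ ∫⁻ x, ρ x ^ (Q / (Q - 1)) ∂μH[Q] < ⊤ ∧
      ∀ E ∈ 𝓕 n, ∫⁻ x in mBdry Q E, ρ x ∂μH[Q - 1] = ⊤) :
    ModF Q (⋃ n, 𝓕 n) = 0 := by
  have hp : 0 < Q / (Q - 1) := div_pos (by linarith) (by linarith)
  set p := Q / (Q - 1) with hpdef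
  choose ρ hρm hρp hρ using h𝓕
  refine nonpos_iff_eq_zero.1 (_root_.le_of_forall_pos_le_add fun ε hε => ?_)
  rw [zero_add]
  obtain ⟨ε', hε', hsum⟩ := ENNReal.exists_pos_sum_of_countable' hε.ne' ℕ
  set M : ℕ → ℝ≥0∞ := fun n => ∫⁻ x, ρ n x ^ p ∂μH[Q] with hM
  have hMtop : ∀ n, M n + 1 ≠ ⊤ := fun n => ENNReal.add_ne_top.2 ⟨(hρp n).ne, by norm_num⟩
  set t : ℕ → ℝ≥0∞ := fun n => (ε' n / (M n + 1)) ^ p⁻¹ with ht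
  have hε'top : ∀ n, ε' n ≠ ⊤ := by
    intro n hn
    have h1 : ∑' i, ε' i = ⊤ := ENNReal.tsum_eq_top_of_eq_top ⟨n, hn⟩
    rw [h1] at hsum
    exact not_top_lt hsum
  have ht0 : ∀ n, t n ≠ 0 := fun n =>
    (ENNReal.rpow_pos (ENNReal.div_pos (hε' n).ne' (hMtop n))
      (ENNReal.div_lt_top (hε'top n) (by simp)).ne).ne'
  have htp : ∀ n, t n ^ p * M n ≤ ε' n := by
    intro n
    rw [ht, ENNReal.rpow_inv_rpow hp.ne']
    calc ε' n / (M n + 1) * M n ≤ ε' n / (M n + 1) * (M n + 1) := by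
          gcongr
          exact le_self_add
      _ ≤ ε' n := (ENNReal.div_mul_cancel (by simp) (hMtop n)).le
  have hadm : ∀ E ∈ ⋃ n, 𝓕 n, 1 ≤ ∫⁻ x in mBdry Q E, ⨆ n, t n * ρ n x ∂μH[Q - 1] := by
    intro E hE
    obtain ⟨n, hn⟩ := mem_iUnion.1 hE
    calc (1 : ℝ≥0∞) ≤ t n * ⊤ := by rw [ENNReal.mul_top (ht0 n)]; exact le_top
      _ = ∫⁻ x in mBdry Q E, t n * ρ n x ∂μH[Q - 1] := by
          rw [lintegral_const_mul _ (hρm n), hρ n E hn]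
      _ ≤ _ := lintegral_mono fun x => le_iSup (fun n => t n * ρ n x) n
  refine (iInf₂_le (fun x => ⨆ n, t n * ρ n x)
    ⟨Measurable.iSup fun n => (hρm n).const_mul _, hadm⟩).trans ?_
  calc _ ≤ ∫⁻ x, ∑' n, (t n * ρ n x) ^ p ∂μH[Q] := by
        refine lintegral_mono fun x => ?_
        rw [← ENNReal.le_rpow_inv_iff hp]
        refine iSup_le fun n => ?_
        rw [ENNReal.le_rpow_inv_iff hp]
        exact ENNReal.le_tsum (f := fun n => (t n * ρ n x) ^ p) n
    _ = ∑' n, ∫⁻ x, (t n * ρ n x) ^ p ∂μH[Q] :=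
        lintegral_tsum fun n => (((hρm n).const_mul _).pow_const p).aemeasurable
    _ ≤ ∑' n, ε' n := by
        refine ENNReal.tsum_le_tsum fun n => ?_
        simp_rw [ENNReal.mul_rpow_of_nonneg _ _ hp.le]
        rw [lintegral_const_mul _ ((hρm n).pow_const p)]
        exact htp n
    _ ≤ ε := hsum.le

/-- For a fixed bounded region there is a single `L^{Q/(Q-1)}` density whose integral over `∂*E`
is infinite as soon as the image of `∂^α E` has infinite codimension one measure. -/
lemma IsQuasisymmetric.exists_density_of_subset_ball {Q : ℝ} (hQ : 1 < Q) [Nontrivial X]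
    {C_A C_A' : ℝ≥0} (hAX : AhlforsRegular X (μH[Q] : Measure X) Q C_A) [Nontrivial Y]
    (hAY : AhlforsRegular Y (μH[Q] : Measure Y) Q C_A') {η : ℝ≥0 ≃ₜ ℝ≥0} {f : X ≃ₜ Y}
    (hf : IsQuasisymmetric η f) {α : ℝ} (hα : 0 < α) (x₀ : X) (R : ℝ) :
    ∃ ρ : X → ℝ≥0∞, Measurable ρ ∧ ∫⁻ x, ρ x ^ (Q / (Q - 1)) ∂μH[Q] < ⊤ ∧
      ∀ E ⊆ ball x₀ R, μH[Q - 1] (f '' alphaBdry Q α E) = ⊤ →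
        ∫⁻ x in mBdry Q E, ρ x ∂μH[Q - 1] = ⊤ := by
  have hQ0 : 0 < Q := by linarith
  have hQ1 : 0 < Q - 1 := by linarith
  have := hAX.sigmaFinite hQ0.le
  have := hAX.secondCountableTopology hQ0.le
  have hp : 1 < Q / (Q - 1) := by rw [lt_div_iff₀ hQ1]; linarith
  have hq : 0 < (Q - 1) / Q := by positivity
  obtain ⟨K, hK, hdiam⟩ := hf.exists_ediam_image_ball_rpow_le hQ hAY
  set ν₀ : Measure X := Measure.map f.symm μH[Q] with hν₀
  have hν₀f : ∀ s, MeasurableSet s → ν₀ s = μH[Q] (f '' s) := fun s hs => by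
    rw [hν₀, Measure.map_apply f.symm.continuous.measurable hs, f.image_eq_preimage_symm]
  set ν : Measure X := ν₀.restrict (ball x₀ (R + 7)) with hν
  have hνf : ∀ x ∈ ball x₀ (R + 1), ∀ r ≤ 6, ν (ball x r) = μH[Q] (f '' ball x r) := by
    intro x hx r hr
    rw [hν, Measure.restrict_eq_self _ (ball_subset_ball' (by linarith [mem_ball.1 hx])),
      hν₀f _ measurableSet_ball]
  have hfin : IsFiniteMeasure ν := by
    refine ⟨?_⟩
    rw [hν, Measure.restrict_apply_univ, hν₀f _ measurableSet_ball]
    obtain ⟨s, hs⟩ := (hf.isBounded_image_ball x₀ (R + 7)).subset_ball_lt 0 (f x₀)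
    exact (measure_mono hs.2).trans_lt (hAY.measure_ball_lt_top hQ0.le _ hs.1)
  set ε : ℕ → ℝ := fun k => 1 / ((k : ℝ) + 1) with hε
  have hε0 : ∀ k, 0 < ε k := fun k => by positivity
  have hε1 : ∀ k, ε k ≤ 1 := fun k => by
    rw [hε, div_le_one (by positivity)]
    linarith [k.cast_nonneg (α := ℝ)]
  have hεlim : Tendsto ε atTop (𝓝 0) := tendsto_one_div_add_atTop_nhds_zero_nat
  have hεQ0 : ∀ k, ENNReal.ofReal (ε k) ^ Q ≠ 0 := fun k =>
    (ENNReal.rpow_pos (ENNReal.ofReal_pos.2 (hε0 k)) ENNReal.ofReal_ne_top).ne'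
  have hεQtop : ∀ k, ENNReal.ofReal (ε k) ^ Q ≠ ⊤ := fun k =>
    ENNReal.rpow_ne_top_of_nonneg hQ0.le ENNReal.ofReal_ne_top
  set G : ℕ → X → ℝ≥0∞ := fun k x =>
    (ν (ball x (7 * ε k)) / ENNReal.ofReal (ε k) ^ Q) ^ ((Q - 1) / Q) with hG
  have hGtop : ∀ k x, G k x ≠ ⊤ := fun k x => ENNReal.rpow_ne_top_of_nonneg hq.le
    (ENNReal.div_lt_top (measure_ne_top _ _) (hεQ0 k)).ne
  have hGm : ∀ k, Measurable (G k) := fun k =>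
    ((measurable_measure_ball ν _).div_const _).pow_const _
  have hGp : ∀ k, ∫⁻ x, ((G k x).toNNReal : ℝ≥0∞) ^ (Q / (Q - 1)) ∂μH[Q] ≤
      C_A * ENNReal.ofReal 7 ^ Q * ν univ := by
    intro k
    have h1 : ∀ x, ((G k x).toNNReal : ℝ≥0∞) ^ (Q / (Q - 1)) =
        (ENNReal.ofReal (ε k) ^ Q)⁻¹ * ν (ball x (7 * ε k)) := fun x => by
      rw [ENNReal.coe_toNNReal (hGtop k x), hG, ← ENNReal.rpow_mul,
        show (Q - 1) / Q * (Q / (Q - 1)) = 1 by field_simp, ENNReal.rpow_one, div_eq_mul_inv,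
        mul_comm]
    simp_rw [h1]
    rw [lintegral_const_mul _ (measurable_measure_ball ν _), lintegral_measure_ball]
    calc _ ≤ (ENNReal.ofReal (ε k) ^ Q)⁻¹ *
          ∫⁻ _, C_A * ENNReal.ofReal (7 * ε k) ^ Q ∂ν := by
          gcongr with y
          exact hAX.measure_ball_le hQ0.le y (mul_pos (by norm_num) (hε0 k))
      _ = _ := by
          rw [lintegral_const, ENNReal.ofReal_mul (by norm_num),
            ENNReal.mul_rpow_of_nonneg _ _ hQ0.le]
          calc _ = ((ENNReal.ofReal (ε k) ^ Q)⁻¹ * ENNReal.ofReal (ε k) ^ Q) *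
                (C_A * ENNReal.ofReal 7 ^ Q * ν univ) := by ring
            _ = _ := by rw [ENNReal.inv_mul_cancel (hεQ0 k) (hεQtop k), one_mul]
  obtain ⟨ρ, hρm, hρp, hρ⟩ := exists_lintegral_rpow_lt_top_forall_liminf_le hp
    (fun k x => (G k x).toNNReal) (fun k => (hGm k).ennreal_toNNReal)
    (ENNReal.mul_lt_top (ENNReal.mul_lt_top ENNReal.coe_lt_top
      (ENNReal.rpow_lt_top_of_nonneg hQ0.le ENNReal.ofReal_ne_top)) (measure_lt_top ν univ)) hGp
  refine ⟨ρ, hρm, hρp, fun E hE htop => ?_⟩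
  set σ : Measure X := (μH[Q - 1] : Measure X).restrict (mBdry Q E) with hσ
  have hρσ := hρ σ
  simp_rw [ENNReal.coe_toNNReal (hGtop _ _)] at hρσ
  have hα0 : ENNReal.ofReal α ≠ 0 := (ENNReal.ofReal_pos.2 hα).ne'
  set A : ℕ → Set X := fun n => {x ∈ mBdry Q E | ∀ r : ℝ, 0 < r → r < 1 / ((n : ℝ) + 1) →
      ENNReal.ofReal α * ENNReal.ofReal r ^ (Q - 1) ≤ μH[Q - 1] (mBdry Q E ∩ ball x r)} with hA
  have hAmono : Monotone A := fun m n hmn x hx => ⟨hx.1, fun r hr hrn =>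
    hx.2 r hr (hrn.trans_le (one_div_le_one_div_of_le (by positivity) (by gcongr)))⟩
  have hAball : ∀ n, A n ⊆ ball x₀ (R + 1) := fun n x hx =>
    closedBall_subset_ball (lt_add_one R) (closure_ball_subset_closedBall
      (closure_mono hE (mBdry_subset_closure Q E hx.1)))
  set L : ℝ≥0∞ := K * (ENNReal.ofReal α)⁻¹ with hL
  have hLtop : L ≠ ⊤ := ENNReal.mul_ne_top hK (ENNReal.inv_ne_top.2 hα0)
  have hAn : ∀ n, μH[Q - 1] (f '' A n) ≤ L * ∫⁻ x, ρ x ∂σ := by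
    intro n
    have hcover : ∀ k, ∃ u : Set X, u.Countable ∧ (ε k < 1 / ((n : ℝ) + 1) →
        u ⊆ A n ∧ A n ⊆ ⋃ x : u, ball (x : X) (6 * ε k) ∧
        ∑' x : u, Metric.ediam (f '' ball (x : X) (6 * ε k)) ^ (Q - 1) ≤
          L * ∫⁻ y, G k y ∂σ) := by
      intro k
      by_cases hk : ε k < 1 / ((n : ℝ) + 1)
      swap
      · exact ⟨∅, countable_empty, fun h => absurd h hk⟩
      have hm : ∀ x ∈ A n,
          ENNReal.ofReal α * ENNReal.ofReal (ε k) ^ (Q - 1) ≤ σ (ball x (ε k)) := fun x hx => by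
        rw [hσ, Measure.restrict_apply measurableSet_ball, inter_comm]
        exact hx.2 _ (hε0 k) hk
      obtain ⟨u, huA, huc, hcov, hsum⟩ := exists_countable_cover_mul_tsum_le (hε0 k) hm
        (g := G k)
        (V := fun x => (ν (ball x (6 * ε k)) / ENNReal.ofReal (ε k) ^ Q) ^ ((Q - 1) / Q))
        (fun x _ y hy => by
          refine ENNReal.rpow_le_rpow (ENNReal.div_le_div_right (measure_mono ?_) _) hq.le
          exact ball_subset_ball' (by linarith [mem_ball'.1 hy]))
      refine ⟨u, huc, fun _ => ⟨huA, hcov, ?_⟩⟩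
      have hV : ∀ x ∈ A n, Metric.ediam (f '' ball x (6 * ε k)) ^ (Q - 1) ≤
          K * (ENNReal.ofReal (ε k) ^ (Q - 1) *
            (ν (ball x (6 * ε k)) / ENNReal.ofReal (ε k) ^ Q) ^ ((Q - 1) / Q)) := by
        intro x hx
        refine (hdiam x (6 * ε k)).trans_eq ?_
        rw [hνf x (hAball n hx) _ (by linarith [hε1 k])]
        congr 1
        have h2 : ENNReal.ofReal (ε k) ^ (Q - 1) =
            (ENNReal.ofReal (ε k) ^ Q) ^ ((Q - 1) / Q) := by
          rw [← ENNReal.rpow_mul]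
          congr 1
          field_simp
        rw [h2, ← ENNReal.mul_rpow_of_nonneg _ _ hq.le, ENNReal.mul_div_cancel (hεQ0 k) (hεQtop k)]
      calc _ ≤ ∑' x : u, K * (ENNReal.ofReal (ε k) ^ (Q - 1) *
            (ν (ball (x : X) (6 * ε k)) / ENNReal.ofReal (ε k) ^ Q) ^ ((Q - 1) / Q)) :=
            ENNReal.tsum_le_tsum fun x => hV x (huA x.2)
        _ = L * (ENNReal.ofReal α * ENNReal.ofReal (ε k) ^ (Q - 1) * ∑' x : u,
            (ν (ball (x : X) (6 * ε k)) / ENNReal.ofReal (ε k) ^ Q) ^ ((Q - 1) / Q)) := by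
            rw [ENNReal.tsum_mul_left, ENNReal.tsum_mul_left, hL]
            set S := ∑' x : u,
              (ν (ball (x : X) (6 * ε k)) / ENNReal.ofReal (ε k) ^ Q) ^ ((Q - 1) / Q)
            calc _ = K * ((ENNReal.ofReal α)⁻¹ * ENNReal.ofReal α) *
                  (ENNReal.ofReal (ε k) ^ (Q - 1) * S) := by
                  rw [ENNReal.inv_mul_cancel hα0 ENNReal.ofReal_ne_top, mul_one]
              _ = _ := by ring
        _ ≤ _ := by gcongr
    choose u huc hu using hcover
    have (k : ℕ) : Countable (u k) := (huc k).to_subtype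
    have hev : ∀ᶠ k in atTop, ε k < 1 / ((n : ℝ) + 1) :=
      hεlim.eventually_lt_const (by positivity)
    have hH := Measure.hausdorffMeasure_le_liminf_tsum (ι := fun k => u k) (Q - 1) (f '' A n) (l := atTop)
      (fun k => ⨆ x ∈ ball x₀ (R + 1), Metric.ediam (f '' ball x (6 * ε k))) ?_
      (fun k x => f '' ball (x : X) (6 * ε k)) ?_ ?_
    · calc _ ≤ _ := hH
        _ ≤ liminf (fun k => L * ∫⁻ y, G k y ∂σ) atTop :=
            liminf_le_liminf (hev.mono fun k hk => (hu k hk).2.2)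
        _ = L * liminf (fun k => ∫⁻ y, G k y ∂σ) atTop :=
            ENNReal.liminf_const_mul_of_ne_top hLtop
        _ ≤ _ := by gcongr
    · rw [ENNReal.tendsto_nhds_zero]
      intro δ hδ
      obtain ⟨δ', hδ', hδδ⟩ : ∃ δ' : ℝ, 0 < δ' ∧ 2 * ENNReal.ofReal δ' ≤ δ := by
        obtain ⟨d, hd0, hd⟩ := ENNReal.lt_iff_exists_nnreal_btwn.1 hδ
        have hd0' : 0 < d := by exact_mod_cast hd0
        refine ⟨d / 2, by positivity, le_trans (le_of_eq ?_) hd.le⟩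
        rw [← ENNReal.ofReal_ofNat, ← ENNReal.ofReal_mul (by norm_num), mul_div_cancel₀ _ two_ne_zero,
          ENNReal.ofReal_coe_nnreal]
      obtain ⟨r₀, hr₀, hr⟩ := hf.exists_forall_dist_le x₀ (R + 1) hδ'
      have h6 : Tendsto (fun k => 6 * ε k) atTop (𝓝 0) := by simpa using hεlim.const_mul 6
      filter_upwards [h6.eventually_lt_const hr₀] with k hk
      refine iSup₂_le fun x hx => le_trans ?_ hδδ
      rw [Metric.ediam_image_le_iff]
      intro y hy z hz
      have h1 : ∀ y ∈ ball x (6 * ε k), edist (f y) (f x) ≤ ENNReal.ofReal δ' := fun y hy => by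
        rw [edist_dist]
        exact ENNReal.ofReal_le_ofReal (hr x hx y ((mem_ball.1 hy).trans hk))
      rw [two_mul]
      exact (edist_triangle_right _ _ (f x)).trans (add_le_add (h1 y hy) (h1 z hz))
    · filter_upwards [hev] with k hk
      intro x
      exact le_iSup₂ (f := fun x (_ : x ∈ ball x₀ (R + 1)) =>
        Metric.ediam (f '' ball x (6 * ε k))) (x : X) (hAball n ((hu k hk).1 x.2))
    · filter_upwards [hev] with k hk
      rw [← image_iUnion]
      exact image_mono (hu k hk).2.1
  have hle : (⊤ : ℝ≥0∞) ≤ L * ∫⁻ x, ρ x ∂σ := by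
    calc (⊤ : ℝ≥0∞) = μH[Q - 1] (f '' alphaBdry Q α E) := htop.symm
      _ ≤ μH[Q - 1] (⋃ n, f '' A n) := by
          rw [← image_iUnion]
          exact measure_mono (image_mono (alphaBdry_subset_iUnion Q α E))
      _ = ⨆ n, μH[Q - 1] (f '' A n) :=
          Monotone.measure_iUnion fun m n hmn => image_mono (hAmono hmn)
      _ ≤ _ := iSup_le hAn
  by_contra hne
  exact ENNReal.mul_ne_top hLtop hne (top_le_iff.1 hle)

/-- for every `α > 0`, the family of bounded Borel sets `E` with
`H^{Q-1}(f(∂^α E)) = ∞` has `Q/(Q-1)`-modulus zero. -/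
theorem stmt12 {Q : ℝ} (hQ : 1 < Q) [Nontrivial X] [Nontrivial Y]
    [CompleteSpace X] [CompleteSpace Y] {C_A C_A' : ℝ≥0}
    (hAX : AhlforsRegular X (μH[Q] : Measure X) Q C_A)
    (hAY : AhlforsRegular Y (μH[Q] : Measure Y) Q C_A')
    (η : ℝ≥0 ≃ₜ ℝ≥0) (f : X ≃ₜ Y) (hf : IsQuasisymmetric η (⇑f)) :
    ∀ α : ℝ, 0 < α →
      ModF Q {E : Set X | MeasurableSet E ∧ Bornology.IsBounded E ∧
        μH[Q - 1] (⇑f '' alphaBdry Q α E) = ⊤} = 0 := by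
  intro α hα
  obtain ⟨x₀, -⟩ := exists_pair_ne X
  have hunion : {E : Set X | MeasurableSet E ∧ Bornology.IsBounded E ∧
      μH[Q - 1] (⇑f '' alphaBdry Q α E) = ⊤} =
      ⋃ n : ℕ, {E : Set X | MeasurableSet E ∧ E ⊆ ball x₀ n ∧
        μH[Q - 1] (⇑f '' alphaBdry Q α E) = ⊤} := by
    ext E
    simp only [mem_iUnion, mem_ofPred_eq]
    constructor
    · rintro ⟨hm, hb, ht⟩
      obtain ⟨r, hr⟩ := hb.subset_ball x₀
      obtain ⟨n, hn⟩ := exists_nat_ge r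
      exact ⟨n, hm, hr.trans (ball_subset_ball hn), ht⟩
    · rintro ⟨n, hm, hb, ht⟩
      exact ⟨hm, isBounded_ball.subset hb, ht⟩
  rw [hunion]
  refine ModF_iUnion_eq_zero hQ _ fun n => ?_
  obtain ⟨ρ, hρm, hρp, hρ⟩ := hf.exists_density_of_subset_ball hQ hAX hAY hα x₀ n
  exact ⟨ρ, hρm, hρp, fun E hE => hρ E hE.2.1 hE.2.2⟩
end
end

section
/- Let Q > 1, let X and Y be complete Ahlfors Q-regular metric spaces (with respect to their Q-dimensional Hausdorff measures), and let f : X → Y be a homeomorphism satisfying the η-quasisymmetry condition. Let U₀ ⊆ X be a set with H^Q(f(U₀)) = 0. Then for every α > 0, the family of all Borel sets E ⊆ X for which H^{Q-1}(f(∂^α E ∩ U₀)) > 0 has Mod_{Q/(Q-1)} equal to zero, where in computing the modulus each such set E is assigned the measure H^{Q-1} restricted to ∂*E, and the base measure on X is H^Q. -/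
open Metric MeasureTheory Filter Topology ENNReal NNReal Set

noncomputable section

variable {X Y : Type*} [MetricSpace X] [MetricSpace Y]
  [MeasurableSpace X] [BorelSpace X] [MeasurableSpace Y] [BorelSpace Y]

set_option linter.unusedSectionVars false

lemma tsum_mul_rpow_le {ι : Type*} (a w : ι → ℝ≥0∞) {p : ℝ} (hp : 0 < p) :
    (∑' i, a i * w i) ^ p ≤ (∑' i, w i) ^ p * ∑' i, a i ^ p := by
  have h (i : ι) : a i ≤ (∑' j, a j ^ p) ^ p⁻¹ :=
    (ENNReal.le_rpow_inv_iff hp).2 (ENNReal.le_tsum (f := fun j => a j ^ p) i)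
  calc (∑' i, a i * w i) ^ p ≤ ((∑' j, a j ^ p) ^ p⁻¹ * ∑' i, w i) ^ p := by
        rw [← ENNReal.tsum_mul_left]
        gcongr with i
        exact h i
    _ = _ := by
        rw [ENNReal.mul_rpow_of_nonneg _ _ hp.le, ENNReal.rpow_inv_rpow hp.ne', mul_comm]

lemma secondCountableTopology_of_hausdorffMeasure_lt_top {d : ℝ} (s : ℕ → Set X)
    (hs : ⋃ n, s n = univ) (hfin : ∀ n, μH[d] (s n) < ⊤) : SecondCountableTopology X := by
  refine EMetric.secondCountable_of_almost_dense_set fun ε hε => ?_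
  have key (n : ℕ) : ∃ t : ℕ → Set X, s n ⊆ ⋃ k, t k ∧ ∀ k, ediam (t k) ≤ ε := by
    have h := hfin n
    rw [Measure.hausdorffMeasure_apply] at h
    have h2 := (le_iSup₂ (f := fun (r : ℝ≥0∞) (_ : 0 < r) =>
      ⨅ (t : ℕ → Set X) (_ : s n ⊆ ⋃ n, t n) (_ : ∀ n, ediam (t n) ≤ r),
          ∑' n, ⨆ _ : (t n).Nonempty, ediam (t n) ^ d) ε hε).trans_lt h
    simp only [iInf_lt_iff] at h2
    obtain ⟨t, h1, h2, -⟩ := h2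
    exact ⟨t, h1, h2⟩
  choose t ht hd using key
  have hc (p : ℕ × ℕ) : ∃ c : Set X, c.Countable ∧ ∀ x ∈ t p.1 p.2, ∃ y ∈ c, y ∈ t p.1 p.2 := by
    rcases (t p.1 p.2).eq_empty_or_nonempty with h | ⟨y, hy⟩
    · exact ⟨∅, countable_empty, by simp [h]⟩
    · exact ⟨{y}, countable_singleton y, fun x _ => ⟨y, rfl, hy⟩⟩
  choose c hcc hcm using hc
  refine ⟨⋃ p, c p, countable_iUnion hcc, eq_univ_of_forall fun x => ?_⟩
  obtain ⟨n, hn⟩ := mem_iUnion.1 (hs.symm ▸ mem_univ x : x ∈ ⋃ n, s n)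
  obtain ⟨k, hk⟩ := mem_iUnion.1 (ht n hn)
  obtain ⟨y, hy, hyt⟩ := hcm (n, k) x hk
  exact mem_biUnion (mem_iUnion.2 ⟨_, hy⟩) ((edist_le_ediam_of_mem hk hyt).trans (hd n k))

lemma AhlforsRegular.measure_ball_lt_top_s13 [Nontrivial X] {μ : Measure X} {Q : ℝ} (hQ : 0 ≤ Q)
    {C : ℝ≥0} (h : AhlforsRegular X μ Q C) (x : X) (r : ℝ) : μ (ball x r) < ⊤ := by
  have small (s : ℝ) (hs : 0 < s) (hs' : ENNReal.ofReal s < 2 * ediam (univ : Set X)) :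
      μ (ball x s) < ⊤ :=
    (h.2 x s hs hs').2.trans_lt
      (ENNReal.mul_lt_top coe_lt_top (ENNReal.rpow_lt_top_of_nonneg hQ ofReal_ne_top))
  have hpos : 0 < ediam (univ : Set X) := ediam_pos_iff.2 nontrivial_univ
  by_cases htop : ediam (univ : Set X) = ⊤
  · refine (measure_mono (ball_subset_ball (le_max_left r 1))).trans_lt
      (small _ (by positivity) (by simp [htop]))
  · have hlt : ediam (univ : Set X) < 2 * ediam (univ : Set X) := by
      rw [two_mul]; exact ENNReal.lt_add_right htop hpos.ne'
    obtain ⟨s, hs1, hs2⟩ := ENNReal.lt_iff_exists_nnreal_btwn.1 hlt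
    have hs0 : 0 < s := by exact_mod_cast hpos.trans hs1
    refine (measure_mono fun y _ => ?_).trans_lt (small s hs0 (by simpa using hs2))
    have : edist y x < s := (edist_le_ediam_of_mem (mem_univ y) (mem_univ x)).trans_lt hs1
    rw [edist_nndist] at this
    exact_mod_cast this

lemma AhlforsRegular.secondCountableTopology_s13 [Nontrivial X] {Q : ℝ} (hQ : 0 ≤ Q)
    {C : ℝ≥0} (h : AhlforsRegular X μH[Q] Q C) : SecondCountableTopology X := by
  obtain ⟨x⟩ := (inferInstance : Nonempty X)
  exact secondCountableTopology_of_hausdorffMeasure_lt_top (fun n : ℕ => ball x n)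
    (iUnion_ball_nat x) fun n => h.measure_ball_lt_top_s13 hQ x n

lemma AhlforsRegular.isLocallyFiniteMeasure [Nontrivial X] {μ : Measure X} {Q : ℝ} (hQ : 0 ≤ Q)
    {C : ℝ≥0} (h : AhlforsRegular X μ Q C) : IsLocallyFiniteMeasure μ :=
  ⟨fun x => ⟨ball x 1, ball_mem_nhds x one_pos, h.measure_ball_lt_top_s13 hQ x 1⟩⟩

lemma exists_lipschitz_radius (W : Set X) (hW : IsOpen W) {δ : ℝ} (hδ : 0 < δ) :
    ∃ g : X → ℝ, (∀ x, g x ≤ δ) ∧ (∀ x ∈ W, 0 < g x) ∧ (∀ x, ball x (g x) ⊆ W) ∧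
      ∀ x y, g x ≤ g y + dist x y := by
  have hfin (x : X) : min (infEDist x Wᶜ) (ENNReal.ofReal δ) ≠ ⊤ :=
    ne_top_of_le_ne_top ofReal_ne_top (min_le_right _ _)
  refine ⟨fun x => (min (infEDist x Wᶜ) (ENNReal.ofReal δ)).toReal, fun x => ?_, fun x hx => ?_,
    fun x y hy => ?_, fun x y => ?_⟩
  · exact ENNReal.toReal_le_of_le_ofReal hδ.le (min_le_right _ _)
  · refine ENNReal.toReal_pos (ne_of_gt (lt_min ?_ (by simpa))) (hfin x)
    rw [infEDist_pos_iff_notMem_closure, hW.isClosed_compl.closure_eq]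
    simpa
  · by_contra hyW
    have h1 : min (infEDist x Wᶜ) (ENNReal.ofReal δ) ≤ edist x y :=
      (min_le_left _ _).trans (infEDist_le_edist_of_mem hyW)
    have h2 := ENNReal.toReal_mono (edist_ne_top x y) h1
    rw [← dist_edist, dist_comm] at h2
    exact absurd (mem_ball.1 hy) (not_lt.2 h2)
  · rw [dist_edist, ← ENNReal.toReal_add (hfin y) (edist_ne_top x y)]
    refine ENNReal.toReal_mono (ENNReal.add_ne_top.2 ⟨hfin y, edist_ne_top x y⟩) ?_
    rw [min_add]
    exact min_le_min infEDist_le_infEDist_add_edist le_self_add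

lemma AhlforsRegular.exists_bounded_overlap_cover [SecondCountableTopology X] {μ : Measure X}
    {Q : ℝ} (hQ : 0 < Q) {C : ℝ≥0} (h : AhlforsRegular X μ Q C) {W : Set X} (hW : IsOpen W)
    {δ : ℝ} (hδ : 0 < δ) (hδX : ENNReal.ofReal δ < ediam (univ : Set X)) :
    ∃ (u : Set X) (r : X → ℝ), u.Countable ∧
      (∀ b ∈ u, 0 < r b ∧ 20 * r b ≤ δ ∧ ball b (r b / 5) ⊆ W) ∧
      u.PairwiseDisjoint (fun b => ball b (r b / 5)) ∧
      W ⊆ ⋃ b ∈ u, closedBall b (r b) ∧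
      ∀ x, ∑' b : u, (ball (b : X) (2 * r b)).indicator 1 x ≤ (C * C * 30 ^ Q : ℝ≥0∞) := by
  obtain ⟨g, hgδ, hgpos, hgW, hgl⟩ := exists_lipschitz_radius W hW hδ
  obtain ⟨u, huW, hud, huc⟩ := Vitali.exists_disjoint_subfamily_covering_enlargement_closedBall
    W id (fun x => g x / 100) δ (fun a _ => by linarith [hgδ a]) 5 (by norm_num)
  have hdisj : u.PairwiseDisjoint (fun b => ball b (g b / 20 / 5)) := fun a ha b hb hab =>
    (hud ha hb hab).mono (ball_subset_closedBall.trans (closedBall_subset_closedBall (by linarith)))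
      (ball_subset_closedBall.trans (closedBall_subset_closedBall (by linarith)))
  have hcount : u.Countable := hdisj.countable_of_isOpen (fun _ _ => isOpen_ball) fun b hb =>
    ⟨b, mem_ball_self (by linarith [hgpos b (huW hb)])⟩
  have hC : (C : ℝ≥0∞) ≠ 0 := by
    have := h.1
    exact_mod_cast (zero_lt_one.trans_le this).ne'
  have hsmall (s : ℝ) (hs : s ≤ δ) : ENNReal.ofReal s < 2 * ediam (univ : Set X) :=
    (ENNReal.ofReal_le_ofReal hs).trans_lt (hδX.trans_le (by rw [two_mul]; exact le_self_add))
  refine ⟨u, fun x => g x / 20, hcount, fun b hb => ?_, hdisj, fun a ha => ?_, fun x => ?_⟩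
  · have := hgpos b (huW hb)
    exact ⟨by linarith, by linarith [hgδ b],
      (ball_subset_ball (by linarith)).trans (hgW b)⟩
  · obtain ⟨b, hb, hab⟩ := huc a ha
    have := hab (mem_closedBall_self (by have := hgpos a ha; linarith))
    refine mem_biUnion hb (closedBall_subset_closedBall ?_ this)
    linarith
  by_cases hx : ∀ b : u, x ∉ ball (b : X) (2 * (g b / 20))
  · simp [indicator_of_notMem (hx _)]
  push Not at hx
  obtain ⟨b₀, hb₀⟩ := hx
  have hgx : 0 < g x := by
    have h1 := hgl b₀ x
    have h2 := mem_ball'.1 hb₀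
    have h3 := hgpos b₀ (huW b₀.2)
    linarith
  have : Countable u := hcount
  set R : ℝ≥0∞ := ENNReal.ofReal (g x / 200) with hR
  have hR0 : R ^ Q ≠ 0 := by
    simp only [ne_eq, ENNReal.rpow_eq_zero_iff, not_or, not_and_or]
    exact ⟨Or.inl (by simp [hR, hgx]), Or.inr (by linarith)⟩
  have hRt : R ^ Q ≠ ⊤ := ENNReal.rpow_ne_top_of_nonneg hQ.le ofReal_ne_top
  have key (b : u) : (ball (b : X) (2 * (g b / 20))).indicator 1 x * (R ^ Q / C) ≤
      μ (ball (b : X) (g b / 20 / 5) ∩ ball x (3 * (g x / 20))) := by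
    by_cases hxb : x ∈ ball (b : X) (2 * (g b / 20))
    · rw [indicator_of_mem hxb, Pi.one_apply, one_mul]
      have h1 := hgl b x
      have h1' := hgl x b
      have h2 := mem_ball'.1 hxb
      rw [dist_comm x b] at h1'
      have h3 := hgpos b (huW b.2)
      have hsub : ball (b : X) (g b / 20 / 5) ⊆ ball x (3 * (g x / 20)) :=
        ball_subset_ball' (by linarith)
      rw [inter_eq_left.2 hsub]
      refine le_trans ?_ (h.2 b (g b / 20 / 5) (by linarith) (hsmall _ (by linarith [hgδ b]))).1
      gcongr
      exact ENNReal.ofReal_le_ofReal (by linarith)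
    · simp [indicator_of_notMem hxb]
  have hsum : (∑' b : u, (ball (b : X) (2 * (g b / 20))).indicator 1 x) * (R ^ Q / C) ≤
      C * (30 ^ Q * R ^ Q) := by
    rw [← ENNReal.tsum_mul_right]
    calc _ ≤ ∑' b : u, μ (ball (b : X) (g b / 20 / 5) ∩ ball x (3 * (g x / 20))) :=
          ENNReal.tsum_le_tsum key
      _ = μ (⋃ b : u, ball (b : X) (g b / 20 / 5) ∩ ball x (3 * (g x / 20))) := by
          refine (measure_iUnion (fun a b hab => ?_) fun b =>
            measurableSet_ball.inter measurableSet_ball).symm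
          exact (hdisj a.2 b.2 (Subtype.coe_injective.ne hab)).mono
            inter_subset_left inter_subset_left
      _ ≤ μ (ball x (3 * (g x / 20))) := measure_mono (iUnion_subset fun _ => inter_subset_right)
      _ ≤ C * ENNReal.ofReal (3 * (g x / 20)) ^ Q :=
          (h.2 x _ (by linarith) (hsmall _ (by linarith [hgδ x]))).2
      _ = _ := by
          rw [← ENNReal.mul_rpow_of_nonneg _ _ hQ.le, hR,
            ← ENNReal.ofReal_ofNat 30, ← ENNReal.ofReal_mul (by norm_num)]
          congr 3
          ring
  rw [← mul_div_assoc, ENNReal.div_le_iff hC coe_ne_top] at hsum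
  refine (ENNReal.mul_le_mul_iff_left hR0 hRt).1 (hsum.trans_eq ?_)
  ring

lemma IsQuasisymmetric.exists_dist_le {η : ℝ≥0 ≃ₜ ℝ≥0} {f : X ≃ₜ Y}
    (hf : IsQuasisymmetric η f) : ∃ K : ℝ≥0, 1 ≤ K ∧ ∀ (x : X) (r : ℝ), 0 < r →
      ∀ w ∈ ball x (2 * r), ∀ z ∉ ball x (r / 5), dist (f x) (f w) ≤ K * dist (f x) (f z) := by
  refine ⟨max 1 (η 10), le_max_left _ _, fun x r hr w hw z hz => ?_⟩
  rcases eq_or_ne x w with rfl | hxw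
  · rw [dist_self]; positivity
  rcases eq_or_ne w z with rfl | hwz
  · exact le_mul_of_one_le_left dist_nonneg (by exact_mod_cast le_max_left _ _)
  have hxz : x ≠ z := by
    rintro rfl
    exact hz (mem_ball_self (by positivity))
  have h := hf hxw hxz hwz 10 (by norm_num) (by
    rw [← NNReal.coe_le_coe]
    push_cast
    simp only [mem_ball', not_lt] at hw hz
    linarith)
  rw [← NNReal.coe_le_coe] at h
  push_cast at h
  refine h.trans ?_
  push_cast
  gcongr
  exact le_max_right _ _

lemma IsQuasisymmetric.exists_ediam_rpow_le [Nontrivial Y] {Q : ℝ} (hQ : 0 < Q) {C : ℝ≥0}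
    {μ : Measure Y}
    (hY : AhlforsRegular Y μ Q C) {η : ℝ≥0 ≃ₜ ℝ≥0} {f : X ≃ₜ Y} (hf : IsQuasisymmetric η f) :
    ∃ K : ℝ≥0∞, K ≠ ⊤ ∧ ∀ (x : X) (r : ℝ), 0 < r → ball x (r / 5) ≠ univ →
      ediam (f '' ball x (2 * r)) ^ Q ≤ K * μ (f '' ball x (r / 5)) := by
  obtain ⟨K, hK1, hK⟩ := hf.exists_dist_le
  have hK0 : (0 : ℝ) < K := by exact_mod_cast zero_lt_one.trans_le hK1
  refine ⟨(2 * K) ^ Q * C, ENNReal.mul_ne_top (ENNReal.rpow_ne_top_of_nonneg hQ.le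
    (ENNReal.mul_ne_top ofNat_ne_top coe_ne_top)) coe_ne_top, fun x r hr hne => ?_⟩
  have hC : (C : ℝ≥0∞) ≠ 0 := by
    have := hY.1
    exact_mod_cast (zero_lt_one.trans_le this).ne'
  have hdiam (z : X) (hz : z ∉ ball x (r / 5)) :
      ediam (f '' ball x (2 * r)) ≤ ENNReal.ofReal (2 * K * dist (f x) (f z)) := by
    refine ediam_le ?_
    rintro _ ⟨w, hw, rfl⟩ _ ⟨w', hw', rfl⟩
    rw [edist_dist]
    refine ENNReal.ofReal_le_ofReal ((dist_triangle_left _ _ (f x)).trans ?_)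
    linarith [hK x r hr w hw z hz, hK x r hr w' hw' z hz]
  obtain ⟨z₀, hz₀⟩ := (ne_univ_iff_exists_notMem _).1 hne
  have hfin : ediam (f '' ball x (2 * r)) ≠ ⊤ := ne_top_of_le_ne_top ofReal_ne_top (hdiam z₀ hz₀)
  obtain ⟨D, hD⟩ : ∃ D : ℝ≥0, (D : ℝ≥0∞) = ediam (f '' ball x (2 * r)) :=
    ⟨_, ENNReal.coe_toNNReal hfin⟩
  rcases eq_or_ne D 0 with rfl | hD0
  · simp [← hD, ENNReal.zero_rpow_of_pos hQ]
  have hDpos : (0 : ℝ) < D := by exact_mod_cast pos_iff_ne_zero.2 hD0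
  have hsub : ball (f x) (D / (2 * K)) ⊆ f '' ball x (r / 5) := by
    intro y hy
    obtain ⟨z, rfl⟩ := f.surjective y
    refine mem_image_of_mem _ ?_
    by_contra hz
    have h1 := hdiam z hz
    rw [← hD, ← ENNReal.ofReal_coe_nnreal, ENNReal.ofReal_le_ofReal_iff (by positivity)] at h1
    rw [mem_ball', lt_div_iff₀ (by positivity)] at hy
    linarith
  have hlt : ENNReal.ofReal (D / (2 * K)) < 2 * ediam (univ : Set Y) := by
    have h1 : ENNReal.ofReal (D / (2 * K)) < D := by
      rw [← ENNReal.ofReal_coe_nnreal, ENNReal.ofReal_lt_ofReal_iff hDpos]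
      have : (1 : ℝ) ≤ K := by exact_mod_cast hK1
      rw [div_lt_iff₀ (by positivity)]
      nlinarith
    refine h1.trans_le ?_
    rw [hD]
    exact (ediam_mono (subset_univ _)).trans (by rw [two_mul]; exact le_self_add)
  have h1 := (hY.2 (f x) _ (by positivity) hlt).1.trans (measure_mono hsub)
  rw [ENNReal.div_le_iff hC coe_ne_top] at h1
  calc ediam (f '' ball x (2 * r)) ^ Q
      = (2 * K) ^ Q * ENNReal.ofReal (D / (2 * K)) ^ Q := by
        rw [← ENNReal.mul_rpow_of_nonneg _ _ hQ.le, ← hD, ← ENNReal.ofReal_coe_nnreal (p := K),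
          ← ENNReal.ofReal_coe_nnreal (p := D), ← ENNReal.ofReal_ofNat 2,
          ← ENNReal.ofReal_mul (by norm_num), ← ENNReal.ofReal_mul (by positivity)]
        congr 2
        field_simp
    _ ≤ (2 * K) ^ Q * (μ (f '' ball x (r / 5)) * C) := by gcongr
    _ = _ := by ring

/-- The sum of `(diam f(2B) / rad B)^(Q-1) · χ_{2B}` over the balls `B` with centre `b ∈ u` and
radius `r b`. -/
def coverDensity (Q : ℝ) (f : X → Y) (u : Set X) (r : X → ℝ) (x : X) : ℝ≥0∞ :=
  ∑' b : u, (ediam (f '' ball (b : X) (2 * r b)) / ENNReal.ofReal (r b)) ^ (Q - 1) *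
    (ball (b : X) (2 * r b)).indicator 1 x

lemma measurable_coverDensity (Q : ℝ) (f : X → Y) {u : Set X} (hu : u.Countable) (r : X → ℝ) :
    Measurable (coverDensity Q f u r) := by
  have : Countable u := hu
  exact Measurable.tsum fun b =>
    (measurable_one.indicator measurableSet_ball).const_mul _

lemma lintegral_coverDensity (Q : ℝ) (f : X → Y) {u : Set X} (hu : u.Countable) (r : X → ℝ)
    (ν : Measure X) :
    ∫⁻ x, coverDensity Q f u r x ∂ν = ∑' b : u,
      (ediam (f '' ball (b : X) (2 * r b)) / ENNReal.ofReal (r b)) ^ (Q - 1) *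
        ν (ball (b : X) (2 * r b)) := by
  have : Countable u := hu
  unfold coverDensity
  rw [lintegral_tsum fun b =>
    ((measurable_one.indicator measurableSet_ball).const_mul _).aemeasurable]
  refine tsum_congr fun b => ?_
  rw [lintegral_const_mul _ (measurable_one.indicator measurableSet_ball),
    lintegral_indicator_one measurableSet_ball]

lemma lintegral_coverDensity_rpow_le {Q : ℝ} (hQ : 1 < Q) (f : X → Y) {u : Set X}
    (hu : u.Countable) {r : X → ℝ} (hr : ∀ b ∈ u, 0 < r b) {μ : Measure X} {C N : ℝ≥0∞}
    (hμ : ∀ b ∈ u, μ (ball b (2 * r b)) ≤ C * ENNReal.ofReal (2 * r b) ^ Q)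
    (hN : ∀ x, ∑' b : u, (ball (b : X) (2 * r b)).indicator 1 x ≤ N) :
    ∫⁻ x, coverDensity Q f u r x ^ (Q / (Q - 1)) ∂μ ≤
      N ^ (Q / (Q - 1)) * (C * 2 ^ Q) * ∑' b : u, ediam (f '' ball (b : X) (2 * r b)) ^ Q := by
  have : Countable u := hu
  have hQ0 : 0 < Q := by linarith
  have hQ1 : 0 < Q - 1 := by linarith
  set p := Q / (Q - 1) with hp
  have hp0 : 0 < p := by positivity
  have hpQ : (Q - 1) * p = Q := by rw [hp]; field_simp
  set D : u → ℝ≥0∞ := fun b => ediam (f '' ball (b : X) (2 * r b)) with hD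
  set R : u → ℝ≥0∞ := fun b => ENNReal.ofReal (r b) with hR
  set χ : u → X → ℝ≥0∞ := fun b => (ball (b : X) (2 * r b)).indicator 1 with hχ
  have hχm (b : u) : Measurable (χ b) := measurable_one.indicator measurableSet_ball
  have hχχ (b : u) (x : X) : χ b x * χ b x = χ b x := by
    by_cases hx : x ∈ ball (b : X) (2 * r b) <;> simp [hχ, hx]
  have hχp (b : u) (x : X) : χ b x ^ p = χ b x := by
    by_cases hx : x ∈ ball (b : X) (2 * r b) <;> simp [hχ, hx, hp0]
  have point (x : X) : coverDensity Q f u r x ^ p ≤ N ^ p * ∑' b : u, (D b / R b) ^ Q * χ b x := by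
    calc coverDensity Q f u r x ^ p
        = (∑' b : u, (D b / R b) ^ (Q - 1) * χ b x * χ b x) ^ p := by
          simp only [mul_assoc, hχχ]; rfl
      _ ≤ (∑' b : u, χ b x) ^ p * ∑' b : u, ((D b / R b) ^ (Q - 1) * χ b x) ^ p :=
          tsum_mul_rpow_le _ _ hp0
      _ ≤ N ^ p * ∑' b : u, (D b / R b) ^ Q * χ b x := by
          gcongr with b
          · exact hN x
          · rw [ENNReal.mul_rpow_of_nonneg _ _ hp0.le, hχp, ← ENNReal.rpow_mul, hpQ]
  calc ∫⁻ x, coverDensity Q f u r x ^ p ∂μ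
      ≤ ∫⁻ x, N ^ p * ∑' b : u, (D b / R b) ^ Q * χ b x ∂μ := lintegral_mono point
    _ = N ^ p * ∑' b : u, (D b / R b) ^ Q * μ (ball (b : X) (2 * r b)) := by
        rw [lintegral_const_mul _ (Measurable.tsum fun b => (hχm b).const_mul _),
          lintegral_tsum fun b => ((hχm b).const_mul _).aemeasurable]
        congr 2 with b
        rw [lintegral_const_mul _ (hχm b), lintegral_indicator_one measurableSet_ball]
    _ ≤ N ^ p * ∑' b : u, C * 2 ^ Q * D b ^ Q := by
        gcongr N ^ p * ?_
        refine ENNReal.tsum_le_tsum fun b => ?_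
        have hb := hr b b.2
        have hR0 : R b ≠ 0 := by simp [hR, hb]
        calc (D b / R b) ^ Q * μ (ball (b : X) (2 * r b))
            ≤ (D b / R b) ^ Q * (C * ENNReal.ofReal (2 * r b) ^ Q) := by
              gcongr; exact hμ b b.2
          _ = C * 2 ^ Q * (D b / R b * R b) ^ Q := by
              rw [ENNReal.ofReal_mul (by norm_num), ENNReal.ofReal_ofNat,
                ENNReal.mul_rpow_of_nonneg _ _ hQ0.le, ENNReal.mul_rpow_of_nonneg _ _ hQ0.le]
              ring
          _ = C * 2 ^ Q * D b ^ Q := by rw [ENNReal.div_mul_cancel hR0 ofReal_ne_top]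
    _ = _ := by rw [ENNReal.tsum_mul_left, ← mul_assoc]

lemma exists_cover_coverDensity_le {Q : ℝ} (hQ : 1 < Q) [Nontrivial X] [Nontrivial Y]
    {C C' : ℝ≥0} (hX : AhlforsRegular X μH[Q] Q C) (hY : AhlforsRegular Y μH[Q] Q C')
    {η : ℝ≥0 ≃ₜ ℝ≥0} {f : X ≃ₜ Y} (hf : IsQuasisymmetric η f) {U : Set X}
    (hU : μH[Q] (f '' U) = 0) {ε : ℝ≥0∞} (hε : ε ≠ 0) {δ : ℝ} (hδ : 0 < δ) :
    ∃ (u : Set X) (r : X → ℝ), u.Countable ∧ (∀ b ∈ u, 0 < r b ∧ r b ≤ δ) ∧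
      U ⊆ ⋃ b ∈ u, closedBall b (r b) ∧
      ∑' b : u, ediam (f '' ball (b : X) (2 * r b)) ^ Q ≤ ε ∧
      ∫⁻ x, coverDensity Q f u r x ^ (Q / (Q - 1)) ∂μH[Q] ≤ ε := by
  have hQ0 : 0 < Q := by linarith
  have hQ1 : 0 < Q - 1 := by linarith
  have := hX.secondCountableTopology_s13 hQ0.le
  have := hY.secondCountableTopology_s13 hQ0.le
  have := hY.isLocallyFiniteMeasure hQ0.le
  obtain ⟨K, hK, hfK⟩ := hf.exists_ediam_rpow_le hQ0 hY
  set p := Q / (Q - 1) with hp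
  have hp0 : 0 < p := by positivity
  set A : ℝ≥0∞ := (C * C * 30 ^ Q) ^ p * (C * 2 ^ Q) with hA
  have hAt : A ≠ ⊤ := by
    have h30 : (30 : ℝ≥0∞) ^ Q ≠ ⊤ := ENNReal.rpow_ne_top_of_nonneg hQ0.le ofNat_ne_top
    have h2 : (2 : ℝ≥0∞) ^ Q ≠ ⊤ := ENNReal.rpow_ne_top_of_nonneg hQ0.le ofNat_ne_top
    exact ENNReal.mul_ne_top (ENNReal.rpow_ne_top_of_nonneg hp0.le (ENNReal.mul_ne_top
      (ENNReal.mul_ne_top coe_ne_top coe_ne_top) h30)) (ENNReal.mul_ne_top coe_ne_top h2)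
  set M : ℝ≥0∞ := (A + 1) * K with hM
  have hMt : M ≠ ⊤ := ENNReal.mul_ne_top (ENNReal.add_ne_top.2 ⟨hAt, one_ne_top⟩) hK
  obtain ⟨V, hUV, hVo, hV⟩ := (f '' U).exists_isOpen_lt_of_lt (ε / M)
    (by rw [hU]; exact ENNReal.div_pos hε hMt)
  obtain ⟨d, hd0, hd⟩ := ENNReal.lt_iff_exists_nnreal_btwn.1
    (ediam_pos_iff.2 (nontrivial_univ (α := X)))
  have hδd : 0 < min δ d := lt_min hδ (by exact_mod_cast hd0)
  have hdX : ENNReal.ofReal (min δ d) < ediam (univ : Set X) :=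
    (ENNReal.ofReal_le_ofReal (min_le_right _ _)).trans_lt (by simpa using hd)
  obtain ⟨u, r, hu, hur, hdisj, hcov, hover⟩ :=
    hX.exists_bounded_overlap_cover hQ0 (hVo.preimage f.continuous) hδd hdX
  have : Countable u := hu
  have hsum : ∑' b : u, ediam (f '' ball (b : X) (2 * r b)) ^ Q ≤ K * (ε / M) := by
    calc ∑' b : u, ediam (f '' ball (b : X) (2 * r b)) ^ Q
        ≤ ∑' b : u, K * μH[Q] (f '' ball (b : X) (r b / 5)) := by
          refine ENNReal.tsum_le_tsum fun b => hfK b (r b) (hur b b.2).1 fun huniv => ?_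
          rw [← huniv] at hdX
          refine absurd hdX (not_lt.2 ?_)
          refine ediam_le fun x hx y hy => ?_
          rw [edist_dist]
          refine ENNReal.ofReal_le_ofReal ?_
          have := (hur b b.2).2.1
          have := (hur b b.2).1
          linarith [mem_ball.1 hx, mem_ball.1 hy, dist_triangle_right x y b]
      _ = K * μH[Q] (⋃ b : u, f '' ball (b : X) (r b / 5)) := by
          rw [ENNReal.tsum_mul_left, measure_iUnion (fun a b hab => ?_) fun b =>
            (f.isOpenMap _ isOpen_ball).measurableSet]
          exact disjoint_image_of_injective f.injective
            (hdisj a.2 b.2 (Subtype.coe_injective.ne hab))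
      _ ≤ K * (ε / M) := by
          gcongr
          refine (measure_mono (iUnion_subset fun b => ?_)).trans hV.le
          exact image_subset_iff.2 (hur b b.2).2.2
  have hKε : (A + 1) * (K * (ε / M)) ≤ ε := by
    rw [← mul_assoc]
    exact ENNReal.mul_div_le
  refine ⟨u, r, hu, fun b hb => ⟨(hur b hb).1, ?_⟩, ?_, ?_, ?_⟩
  · have := (hur b hb).1
    have := (hur b hb).2.1
    linarith [min_le_left δ d]
  · exact (image_subset_iff.1 hUV).trans hcov
  · refine hsum.trans (le_trans ?_ hKε)
    exact le_mul_of_one_le_left zero_le le_add_self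
  · refine (lintegral_coverDensity_rpow_le hQ f hu (C := C)
      (fun b hb => (hur b hb).1) (fun b hb => ?_) hover).trans ?_
    · have h1 := (hur b hb).1
      refine (hX.2 b _ (by linarith) (lt_of_le_of_lt ?_ (hdX.trans_le
        (by rw [two_mul]; exact le_self_add)))).2
      exact ENNReal.ofReal_le_ofReal (by linarith [(hur b hb).2.1])
    · calc A * ∑' b : u, ediam (f '' ball (b : X) (2 * r b)) ^ Q
          ≤ (A + 1) * (K * (ε / M)) := by
            gcongr
            exact le_self_add
        _ ≤ ε := hKε

lemma mul_tsum_le_lintegral_coverDensity {Q : ℝ} (hQ : 1 < Q) (f : X → Y) {u : Set X}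
    (hu : u.Countable) {r : X → ℝ} {δ : ℝ} (hr : ∀ b ∈ u, 0 < r b ∧ r b ≤ δ) {ν : Measure X}
    {a : ℝ≥0∞} {A : Set X}
    (hA : ∀ x ∈ A, ∀ s : ℝ, 0 < s → s ≤ δ → a * ENNReal.ofReal s ^ (Q - 1) ≤ ν (ball x s)) :
    a * ∑' b : {b : u // (A ∩ closedBall (b : X) (r b)).Nonempty},
        ediam (f '' ball (b : X) (2 * r b)) ^ (Q - 1) ≤
      ∫⁻ x, coverDensity Q f u r x ∂ν := by
  rw [lintegral_coverDensity Q f hu, ← ENNReal.tsum_mul_left]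
  refine le_trans (ENNReal.tsum_le_tsum fun b => ?_)
    (ENNReal.tsum_comp_le_tsum_of_injective Subtype.val_injective _)
  obtain ⟨x, hxA, hxb⟩ := b.2
  obtain ⟨h0, h1⟩ := hr b b.1.2
  have hsub : ball x (r b) ⊆ ball (b : X) (2 * r b) :=
    ball_subset_ball' (by linarith [mem_closedBall.1 hxb])
  have h2 := (hA x hxA _ h0 h1).trans (measure_mono hsub)
  calc a * ediam (f '' ball (b : X) (2 * r b)) ^ (Q - 1)
      = a * (ediam (f '' ball (b : X) (2 * r b)) / ENNReal.ofReal (r b) *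
          ENNReal.ofReal (r b)) ^ (Q - 1) := by
        rw [ENNReal.div_mul_cancel (by simp [h0]) ofReal_ne_top]
    _ = (ediam (f '' ball (b : X) (2 * r b)) / ENNReal.ofReal (r b)) ^ (Q - 1) *
          (a * ENNReal.ofReal (r b) ^ (Q - 1)) := by
        rw [ENNReal.mul_rpow_of_nonneg _ _ (by linarith)]
        ring
    _ ≤ _ := by gcongr

lemma exists_hausdorffMeasure_image_pos {Q α : ℝ} {f : X → Y}
    {E U : Set X} (h : 0 < μH[Q - 1] (f '' (alphaBdry Q α E ∩ U))) :
    ∃ A ⊆ U, 0 < μH[Q - 1] (f '' A) ∧ ∃ δ : ℝ, 0 < δ ∧ ∀ x ∈ A, ∀ s : ℝ, 0 < s → s ≤ δ →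
      ENNReal.ofReal α * ENNReal.ofReal s ^ (Q - 1) ≤
        (μH[Q - 1]).restrict (mBdry Q E) (ball x s) := by
  set A : ℕ → Set X := fun k => {x ∈ alphaBdry Q α E ∩ U | ∀ s : ℝ, 0 < s → s ≤ 1 / (k + 1 : ℝ) →
      ENNReal.ofReal α * ENNReal.ofReal s ^ (Q - 1) ≤
        (μH[Q - 1]).restrict (mBdry Q E) (ball x s)} with hA
  have hcov : alphaBdry Q α E ∩ U ⊆ ⋃ k, A k := by
    intro x hx
    have hev := eventually_lt_of_lt_liminf hx.1.2
    rw [Filter.Eventually, mem_nhdsGT_iff_exists_Ioo_subset] at hev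
    obtain ⟨t, ht, hsub⟩ := hev
    obtain ⟨k, hk⟩ := exists_nat_one_div_lt (mem_Ioi.1 ht)
    refine mem_iUnion.2 ⟨k, hx, fun s hs hsk => ?_⟩
    have := hsub ⟨hs, hsk.trans_lt hk⟩
    rw [Measure.restrict_apply measurableSet_ball, inter_comm]
    exact ENNReal.mul_le_of_le_div (le_of_lt this)
  by_contra! hcon
  refine h.ne' (measure_mono_null (image_mono hcov) ?_)
  rw [image_iUnion, measure_iUnion_null_iff]
  intro k
  by_contra hne
  obtain ⟨x, hx, s, hs, hsk, hlt⟩ := hcon (A k) (fun x hx => hx.1.2) (pos_iff_ne_zero.2 hne)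
    (1 / (k + 1 : ℝ)) (by positivity)
  exact absurd (hx.2 s hs hsk) (not_le.2 hlt)

lemma modF_eq_zero {Q : ℝ} (hQ : 1 < Q) {F : Set (Set X)} {ρ : X → ℝ≥0∞} (hρ : Measurable ρ)
    (hint : ∫⁻ x, ρ x ^ (Q / (Q - 1)) ∂(μH[Q] : Measure X) ≠ ⊤)
    (hF : ∀ E ∈ F, ∫⁻ x in mBdry Q E, ρ x ∂(μH[Q - 1] : Measure X) = ⊤) : ModF Q F = 0 := by
  have hp0 : 0 < Q / (Q - 1) := div_pos (by linarith) (by linarith)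
  set p := Q / (Q - 1)
  have hle (n : ℕ) : ModF Q F ≤ 2⁻¹ ^ n * ∫⁻ x, ρ x ^ p ∂(μH[Q] : Measure X) := by
    have hc0 : ((2⁻¹ : ℝ≥0∞) ^ n) ^ p⁻¹ ≠ 0 := by simp
    refine (iInf₂_le (fun x => (2⁻¹ ^ n) ^ p⁻¹ * ρ x)
      ⟨hρ.const_mul _, fun E hE => ?_⟩).trans_eq ?_
    · change ∫⁻ x, ((2⁻¹ ^ n) ^ p⁻¹ * ρ x) ^ p ∂(μH[Q] : Measure X) = _
      rw [← lintegral_const_mul _ (hρ.pow_const p)]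
      refine lintegral_congr fun x => ?_
      rw [ENNReal.mul_rpow_of_nonneg _ _ hp0.le, ENNReal.rpow_inv_rpow hp0.ne']
    · change 1 ≤ ∫⁻ x in mBdry Q E, (2⁻¹ ^ n) ^ p⁻¹ * ρ x ∂(μH[Q - 1] : Measure X)
      rw [lintegral_const_mul _ hρ, hF E hE, ENNReal.mul_top hc0]
      exact le_top
  have hlim := ENNReal.Tendsto.mul_const (b := ∫⁻ x, ρ x ^ p ∂(μH[Q] : Measure X))
    (ENNReal.tendsto_pow_atTop_nhds_zero_of_lt_one (r := 2⁻¹) (by simp))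
    (Or.inr hint)
  rw [zero_mul] at hlim
  exact le_antisymm (ge_of_tendsto' hlim hle) zero_le

/-- if `H^Q(f(U₀)) = 0`, then for every `α > 0` the family of Borel sets `E`
with `H^{Q-1}(f(∂^α E ∩ U₀)) > 0` has `Q/(Q-1)`-modulus zero. -/
theorem stmt13 {Q : ℝ} (hQ : 1 < Q) [Nontrivial X] [Nontrivial Y]
    [CompleteSpace X] [CompleteSpace Y] {C_A C_A' : ℝ≥0}
    (hAX : AhlforsRegular X (μH[Q] : Measure X) Q C_A)
    (hAY : AhlforsRegular Y (μH[Q] : Measure Y) Q C_A')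
    (η : ℝ≥0 ≃ₜ ℝ≥0) (f : X ≃ₜ Y) (hf : IsQuasisymmetric η (⇑f))
    (U₀ : Set X) (hU₀ : μH[Q] (⇑f '' U₀) = 0) :
    ∀ α : ℝ, 0 < α →
      ModF Q {E : Set X | MeasurableSet E ∧
        0 < μH[Q - 1] (⇑f '' (alphaBdry Q α E ∩ U₀))} = 0 := by
  intro α hα
  have hQ0 : 0 < Q := by linarith
  have hp0 : 0 < Q / (Q - 1) := div_pos (by linarith) (by linarith)
  set p := Q / (Q - 1) with hp
  set ε : ℕ → ℝ≥0∞ := fun n => 2⁻¹ ^ n * (2⁻¹ ^ n) ^ p with hε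
  have hε0 (n : ℕ) : ε n ≠ 0 := mul_ne_zero (by simp) (by simp)
  have hεlim : Tendsto (fun n => ε n ^ Q⁻¹) atTop (𝓝 0) := by
    have h1 : Tendsto (fun n : ℕ => (2⁻¹ : ℝ≥0∞) ^ n) atTop (𝓝 0) :=
      ENNReal.tendsto_pow_atTop_nhds_zero_of_lt_one (by simp)
    have h2 : Tendsto ε atTop (𝓝 0) := by
      refine tendsto_of_tendsto_of_tendsto_of_le_of_le tendsto_const_nhds h1
        (fun _ => zero_le) fun n => mul_le_of_le_one_right zero_le ?_
      exact ENNReal.rpow_le_one (pow_le_one₀ zero_le (by simp)) hp0.le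
    simpa [hQ0] using h2.ennrpow_const Q⁻¹
  choose u r hu hur hcov hsum hint using fun n : ℕ =>
    exists_cover_coverDensity_le hQ hAX hAY hf hU₀ (hε0 n) (Nat.one_div_pos_of_nat (α := ℝ) (n := n))
  have hmeas (n : ℕ) : Measurable (coverDensity Q f (u n) (r n)) :=
    measurable_coverDensity Q f (hu n) (r n)
  refine modF_eq_zero hQ (ρ := fun x => ∑' n, coverDensity Q f (u n) (r n) x)
    (Measurable.tsum hmeas) ?_ ?_
  · have h2 (n : ℕ) : (2 : ℝ≥0∞) ^ n * 2⁻¹ ^ n = 1 := by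
      rw [← mul_pow, ENNReal.mul_inv_cancel (by simp) (by simp), one_pow]
    have hgeom : ∑' n : ℕ, (2⁻¹ : ℝ≥0∞) ^ n = 2 := by
      rw [ENNReal.tsum_geometric, ENNReal.one_sub_inv_two, inv_inv]
    have hle : ∫⁻ x, (∑' n, coverDensity Q f (u n) (r n) x) ^ p ∂(μH[Q] : Measure X) ≤
        2 ^ p * 2 := by
      calc ∫⁻ x, (∑' n, coverDensity Q f (u n) (r n) x) ^ p ∂(μH[Q] : Measure X)
          ≤ ∫⁻ x, 2 ^ p * ∑' n, (2 ^ n) ^ p * coverDensity Q f (u n) (r n) x ^ p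
              ∂(μH[Q] : Measure X) := by
            refine lintegral_mono fun x => ?_
            have := tsum_mul_rpow_le (fun n => 2 ^ n * coverDensity Q f (u n) (r n) x)
              (fun n => (2⁻¹ : ℝ≥0∞) ^ n) hp0
            simpa only [mul_right_comm _ _ ((2⁻¹ : ℝ≥0∞) ^ _), h2, one_mul, hgeom,
              ENNReal.mul_rpow_of_nonneg _ _ hp0.le] using this
        _ = 2 ^ p * ∑' n, (2 ^ n) ^ p *
              ∫⁻ x, coverDensity Q f (u n) (r n) x ^ p ∂(μH[Q] : Measure X) := by
            have hm (n : ℕ) : Measurable fun x =>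
                ((2 : ℝ≥0∞) ^ n) ^ p * coverDensity Q f (u n) (r n) x ^ p :=
              ((hmeas n).pow_const p).const_mul _
            rw [lintegral_const_mul _ (Measurable.tsum hm),
              lintegral_tsum fun n => (hm n).aemeasurable]
            congr 2 with n
            exact lintegral_const_mul _ ((hmeas n).pow_const p)
        _ ≤ 2 ^ p * ∑' n, (2 ^ n) ^ p * ε n := by
            gcongr with n
            exact hint n
        _ = 2 ^ p * 2 := by
            rw [(tsum_congr fun n => ?_).trans hgeom]
            rw [hε, mul_left_comm, ← ENNReal.mul_rpow_of_nonneg _ _ hp0.le, h2,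
              ENNReal.one_rpow, mul_one]
    exact ne_top_of_le_ne_top (ENNReal.mul_ne_top
      (ENNReal.rpow_ne_top_of_nonneg hp0.le ofNat_ne_top) ofNat_ne_top) hle
  · rintro E ⟨-, hE⟩
    obtain ⟨A, hAU, hA, δ, hδ, hAδ⟩ := exists_hausdorffMeasure_image_pos hE
    rw [lintegral_tsum fun n => (hmeas n).aemeasurable]
    have hcount (n : ℕ) : Countable (u n) := hu n
    have hlim := Measure.hausdorffMeasure_le_liminf_tsum (Q - 1) (f '' A)
      (ι := fun n => {b : u n // (A ∩ closedBall (b : X) (r n b)).Nonempty}) (l := atTop)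
      (fun n => ε n ^ Q⁻¹) hεlim (fun n b => f '' ball (b : X) (2 * r n b))
      (Eventually.of_forall fun n b => ?_) (Eventually.of_forall fun n => ?_)
    · obtain ⟨c, hc0, hc⟩ := exists_between (hA.trans_le hlim)
      by_contra hne
      have hzero := ENNReal.tendsto_atTop_zero_of_tsum_ne_top hne
      have hpos : 0 < ENNReal.ofReal α * c := ENNReal.mul_pos (by simpa) hc0.ne'
      obtain ⟨k, hk⟩ := exists_nat_one_div_lt hδ
      obtain ⟨n, hn1, hn2, hn3⟩ := ((eventually_lt_of_lt_liminf hc).and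
        ((hzero.eventually_lt_const hpos).and (eventually_ge_atTop k))).exists
      refine absurd hn2 (not_lt.2 (le_trans ?_ (mul_tsum_le_lintegral_coverDensity hQ f (hu n)
        (hur n) fun x hx s hs hsn => hAδ x hx s hs (hsn.trans (le_trans ?_ hk.le)))))
      · gcongr
      · exact Nat.one_div_le_one_div hn3
    · rw [ENNReal.le_rpow_inv_iff hQ0]
      exact (ENNReal.le_tsum (f := fun b : u n => ediam (f '' ball (b : X) (2 * r n b)) ^ Q)
        b.1).trans (hsum n)
    · rintro _ ⟨x, hx, rfl⟩
      obtain ⟨b, hb, hxb⟩ := mem_iUnion₂.1 (hcov n (hAU hx))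
      refine mem_iUnion.2 ⟨⟨⟨b, hb⟩, x, hx, hxb⟩, mem_image_of_mem _ ?_⟩
      exact closedBall_subset_ball (by linarith [(hur n b hb).1]) hxb
end
end

section
/- Let X and Y be metric spaces each equipped with a Borel measure positive and finite on balls, let f : X → Y be a homeomorphism, let d ≥ 0, and let P = {x ∈ X : L_f(x) = 0 or L_f(x) = ∞}. Let E ⊆ X be a Borel set such that H^d(f(Σ E ∩ P)) = 0. Then the pull-back under f of H^d restricted to f((∂*E \ P) ∪ Σ E) is absolutely continuous with respect to H^d restricted to ∂*E; that is, for every set N ⊆ ∂*E with H^d(N) = 0 one has H^d(f(N ∩ ((∂*E \ P) ∪ Σ E))) = 0. -/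
open Metric MeasureTheory Filter Topology ENNReal NNReal Set

noncomputable section

variable {X Y : Type*} [MetricSpace X] [MetricSpace Y]
  [MeasurableSpace X] [BorelSpace X] [MeasurableSpace Y] [BorelSpace Y]

/-- `L_f(x) = limsup_{r→0⁺} L_f(x,r)/r`, taken in `[0,∞]`. -/
def Lfd (f : X → Y) (x : X) : ℝ≥0∞ :=
  limsup (fun r : ℝ => Lfr f x r / ENNReal.ofReal r) (𝓝[>] (0 : ℝ))

/-- The singular set `P = {x : L_f(x) = 0 or L_f(x) = ∞}`. -/
def singSet (f : X → Y) : Set X :=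
  {x | Lfd f x = 0 ∨ Lfd f x = ⊤}

/-- If `f` is `K`-Lipschitz on `s` at scales smaller than `δ`, then the image under `f` of an
`H^d`-null set `s` is `H^d`-null. -/
lemma hausdorffMeasure_image_eq_zero_of_edist_le {f : X → Y} {s : Set X} {d : ℝ} (hd : 0 ≤ d)
    {K : ℝ≥0} {δ : ℝ≥0∞} (hδ : 0 < δ)
    (hf : ∀ x ∈ s, ∀ y ∈ s, edist x y ≤ δ → edist (f x) (f y) ≤ K * edist x y)
    (hs : μH[d] s = 0) : μH[d] (f '' s) = 0 := by
  obtain ⟨t, hst, ht⟩ : ∃ t : ℕ → Set X, s ⊆ ⋃ n, t n ∧ ∀ n, ediam (t n) ≤ δ := by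
    by_contra! h
    rw [Measure.hausdorffMeasure_apply] at hs
    have h0 := ENNReal.iSup_eq_zero.1 (ENNReal.iSup_eq_zero.1 hs δ) hδ
    have htop : (⊤ : ℝ≥0∞) ≤ 0 := by
      rw [← h0]
      refine le_iInf fun t => le_iInf fun hst => le_iInf fun ht => ?_
      obtain ⟨n, hn⟩ := h t hst
      exact absurd (ht n) hn.not_ge
    simp at htop
  have hsub : f '' s ⊆ ⋃ n, f '' (s ∩ t n) := by
    rw [← image_iUnion, ← inter_iUnion]
    exact image_mono (subset_inter Subset.rfl hst)
  refine measure_mono_null hsub (measure_iUnion_null fun n => ?_)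
  have hlip : LipschitzOnWith K f (s ∩ t n) := fun x hx y hy =>
    hf x hx.1 y hy.1 ((edist_le_ediam_of_mem hx.2 hy.2).trans (ht n))
  have hle := hlip.hausdorffMeasure_image_le hd
  rw [measure_mono_null inter_subset_left hs, mul_zero] at hle
  exact nonpos_iff_eq_zero.1 hle

/-- The points at which `L_f(x,r) ≤ k r` for all radii `0 < r < 1 / (m + 1)`. -/
def LfrBoundedSet (f : X → Y) (k m : ℕ) : Set X :=
  {x | ∀ r : ℝ, 0 < r → r < 1 / ((m : ℝ) + 1) → Lfr f x r ≤ k * ENNReal.ofReal r}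

omit [MeasurableSpace X] [BorelSpace X] [MeasurableSpace Y] [BorelSpace Y] in
lemma exists_mem_LfrBoundedSet {f : X → Y} {x : X} (hx : Lfd f x ≠ ⊤) :
    ∃ k m : ℕ, x ∈ LfrBoundedSet f k m := by
  obtain ⟨k, hk⟩ := ENNReal.exists_nat_gt hx
  obtain ⟨δ, hδ, h⟩ := mem_nhdsGT_iff_exists_Ioo_subset.1 (eventually_lt_of_limsup_lt hk)
  obtain ⟨m, hm⟩ := exists_nat_one_div_lt (mem_Ioi.1 hδ)
  refine ⟨k, m, fun r hr hrm => ?_⟩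
  have hlt : Lfr f x r / ENNReal.ofReal r < k := h ⟨hr, hrm.trans hm⟩
  exact (ENNReal.div_le_iff (ENNReal.ofReal_pos.2 hr).ne' ENNReal.ofReal_ne_top).1 hlt.le

omit [MeasurableSpace X] [BorelSpace X] [MeasurableSpace Y] [BorelSpace Y] in
lemma edist_le_of_mem_LfrBoundedSet {f : X → Y} {k m : ℕ} {x y : X}
    (hx : x ∈ LfrBoundedSet f k m) (hxy : dist x y < 1 / ((m : ℝ) + 1)) :
    edist (f x) (f y) ≤ k * edist x y := by
  rcases eq_or_ne x y with rfl | hne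
  · simp
  · rw [edist_dist x y]
    have hy : y ∈ closedBall x (dist x y) := by simp [dist_comm]
    exact (le_iSup₂ (f := fun z (_ : z ∈ closedBall x (dist x y)) => edist (f x) (f z)) y hy).trans
      (hx _ (dist_pos.2 hne) hxy)

/-- The image under `f` of an `H^d`-null set on which `L_f` is finite is `H^d`-null. -/
lemma hausdorffMeasure_image_eq_zero_of_Lfd_ne_top {f : X → Y} {s : Set X} {d : ℝ} (hd : 0 ≤ d)
    (hf : ∀ x ∈ s, Lfd f x ≠ ⊤) (hs : μH[d] s = 0) : μH[d] (f '' s) = 0 := by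
  have hsub : f '' s ⊆ ⋃ (k : ℕ) (m : ℕ), f '' (s ∩ LfrBoundedSet f k m) := by
    rintro _ ⟨x, hx, rfl⟩
    obtain ⟨k, m, hkm⟩ := exists_mem_LfrBoundedSet (hf x hx)
    exact mem_iUnion₂.2 ⟨k, m, x, ⟨hx, hkm⟩, rfl⟩
  refine measure_mono_null hsub
    (measure_iUnion_null fun k => measure_iUnion_null fun m => ?_)
  have hm : (0 : ℝ) < 1 / ((m : ℝ) + 1) := by positivity
  refine hausdorffMeasure_image_eq_zero_of_edist_le hd (K := k)
    (ENNReal.ofReal_pos.2 (half_pos hm)) (fun x hx y _ hxy => ?_)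
    (measure_mono_null inter_subset_left hs)
  rw [edist_dist, ENNReal.ofReal_le_ofReal_iff (half_pos hm).le] at hxy
  simpa using edist_le_of_mem_LfrBoundedSet hx.2 (hxy.trans_lt (half_lt_self hm))

/-- if `H^d(f(Σ E ∩ P)) = 0`, then the pull-back under `f` of
`H^d⌞f((∂*E \ P) ∪ Σ E)` is absolutely continuous with respect to `H^d⌞∂*E`. -/
theorem stmt14 (μX : Measure X) (μY : Measure Y)
    (hμX : ∀ (x : X) (r : ℝ), 0 < r → 0 < μX (Metric.ball x r) ∧ μX (Metric.ball x r) < ⊤)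
    (hμY : ∀ (y : Y) (r : ℝ), 0 < r → 0 < μY (Metric.ball y r) ∧ μY (Metric.ball y r) < ⊤)
    (f : X ≃ₜ Y) {d : ℝ} (hd : 0 ≤ d) (E : Set X) (hE : MeasurableSet E)
    (hP : μH[d] (⇑f '' (SigmaSet μX E ∩ singSet (⇑f))) = 0) :
    ∀ N ⊆ measBdry μX E, μH[d] N = 0 →
      μH[d] (⇑f '' (N ∩ ((measBdry μX E \ singSet (⇑f)) ∪ SigmaSet μX E))) = 0 := by
  intro N _ hN
  have hsub : ⇑f '' (N ∩ ((measBdry μX E \ singSet ⇑f) ∪ SigmaSet μX E)) ⊆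
      ⇑f '' (N \ singSet ⇑f) ∪ ⇑f '' (SigmaSet μX E ∩ singSet ⇑f) := by
    rw [← image_union]
    refine image_mono fun x ⟨hxN, hx⟩ => ?_
    by_cases hxP : x ∈ singSet ⇑f
    · exact Or.inr ⟨hx.resolve_left fun h => h.2 hxP, hxP⟩
    · exact Or.inl ⟨hxN, hxP⟩
  refine measure_mono_null hsub (measure_union_null ?_ hP)
  exact hausdorffMeasure_image_eq_zero_of_Lfd_ne_top hd (fun x hx h => hx.2 (Or.inr h))
    (measure_mono_null sdiff_subset hN)
end
end
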